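/- arXiv:2502.15982 — 9 statements merged into one kernel-verified Lean document; each statement's English description precedes it below -/
import Mathlib

section
/- Let G = (V,E) be a finite undirected graph with no isolated vertices, let S ⊆ V, and let k be a positive integer with h_S(G) > k. Then every hunter strategy (W_t)_{t≥1} on G using k hunters (i.e., |W_t| ≤ k for all t) satisfies R_τ ∩ S ≠ ∅ for every τ ≥ 1, where R_t is the rabbit territory with the rabbit allowed to start anywhere (R_1 = V \ W_1). -/
/-- `nbhd adj A` is the set of vertices having at least one neighbor in `A`
(for the symmetric adjacency relation `adj`, which may have loops). -/
def nbhd {V : Type*} (adj : V → V → Prop) (A : Set V) : Set V :=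
  {v | ∃ u ∈ A, adj u v}

/-- Rabbit territory at (0-indexed) time `t` against the hunter strategy `W`,
when the rabbit may start anywhere in `S`.  (`terr adj S W (t-1)` is the set `R_t`
of the paper: `R_1 = S \ W_1`, `R_t = N(R_{t-1}) \ W_t`.) -/
def terr {V : Type*} (adj : V → V → Prop) (S : Set V) (W : ℕ → Set V) : ℕ → Set V
  | 0 => S \ W 0
  | t + 1 => nbhd adj (terr adj S W t) \ W (t + 1)

/-- The hunter strategy `W` uses at most `k` hunters. -/
def UsesAtMost {V : Type*} (W : ℕ → Set V) (k : ℕ) : Prop :=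
  ∀ t, (W t).ncard ≤ k

/-- The hunting number when the rabbit is restricted to start in `S`:
the least `k` for which some strategy using `k` hunters empties the territory. -/
noncomputable def huntingNumberFrom {V : Type*} (adj : V → V → Prop) (S : Set V) : ℕ :=
  sInf {k | ∃ W : ℕ → Set V, UsesAtMost W k ∧ ∃ T, terr adj S W T = ∅}

/-- The hunting number `h(G)`. -/
noncomputable def huntingNumber {V : Type*} (adj : V → V → Prop) : ℕ :=
  huntingNumberFrom adj Set.univ

/-- The hunting number with time limit `l ≥ 1`, `h(G,l)`:
the strategy `W_1, …, W_l` corresponds to indices `0, …, l-1`, and the rabbit must be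
caught by round `l`, i.e. `R_l = terr … (l-1) = ∅`. -/
noncomputable def huntingNumberTL {V : Type*} (adj : V → V → Prop) (l : ℕ) : ℕ :=
  sInf {k | ∃ W : ℕ → Set V, UsesAtMost W k ∧ terr adj Set.univ W (l - 1) = ∅}

/-- Every vertex of the territory at time `t` is the end of a walk that starts in `S` and avoids
the hunters. -/
theorem exists_walk_of_mem_terr {V : Type*} {adj : V → V → Prop} {S : Set V} {W : ℕ → Set V}
    {t : ℕ} {v : V} (hv : v ∈ terr adj S W t) :
    ∃ f : ℕ → V, f 0 ∈ S ∧ f t = v ∧ (∀ i < t, adj (f i) (f (i + 1))) ∧ ∀ i ≤ t, f i ∉ W i := by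
  induction t generalizing v with
  | zero => exact ⟨fun _ => v, hv.1, rfl, by simp, fun i hi => by
      obtain rfl : i = 0 := by omega
      exact hv.2⟩
  | succ t ih =>
    obtain ⟨⟨u, hu, huv⟩, hvW⟩ := hv
    obtain ⟨f, hf0, rfl, hadj, hW⟩ := ih hu
    refine ⟨fun i => if i ≤ t then f i else v, by simpa using hf0, by simp, fun i hi => ?_,
      fun i hi => ?_⟩
    · rcases Nat.lt_succ_iff_lt_or_eq.mp hi with hi | rfl
      · simpa [hi.le, Nat.succ_le_of_lt hi] using hadj i hi
      · simpa using huv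
    · rcases Nat.le_succ_iff.mp hi with hi | rfl
      · simpa [hi] using hW i hi
      · simpa using hvW

/-- A walk that starts in `S` and avoids the hunters stays in the territory. -/
theorem mem_terr_of_walk {V : Type*} {adj : V → V → Prop} {S : Set V} {W : ℕ → Set V}
    {t : ℕ} {f : ℕ → V} (hS : f 0 ∈ S) (hadj : ∀ i < t, adj (f i) (f (i + 1)))
    (hW : ∀ i ≤ t, f i ∉ W i) : f t ∈ terr adj S W t := by
  induction t with
  | zero => exact ⟨hS, hW 0 le_rfl⟩
  | succ t ih =>
    exact ⟨⟨f t, ih (fun i hi => hadj i (by omega)) (fun i hi => hW i (by omega)),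
      hadj t (by omega)⟩, hW _ le_rfl⟩

/-- Reversing time: if the rabbit cannot end in `S` at time `τ` against `W`, then the strategy
playing `W` backwards catches every rabbit that starts in `S` by time `τ`. -/
theorem terr_reverse_eq_empty {V : Type*} {adj : V → V → Prop} (hsymm : Symmetric adj)
    {S : Set V} {W : ℕ → Set V} {τ : ℕ} (h : terr adj Set.univ W τ ∩ S = ∅) :
    terr adj S (fun t => W (τ - t)) τ = ∅ := by
  refine Set.eq_empty_of_forall_notMem fun v hv => ?_
  obtain ⟨f, hf0, -, hadj, hW⟩ := exists_walk_of_mem_terr hv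
  have hmem : f (τ - τ) ∈ terr adj Set.univ W τ := by
    refine mem_terr_of_walk (f := fun i => f (τ - i)) (Set.mem_univ _) (fun i hi => ?_)
      (fun i hi => ?_)
    · have hstep := hadj (τ - (i + 1)) (by omega)
      rw [show τ - (i + 1) + 1 = τ - i by omega] at hstep
      exact hsymm hstep
    · simpa [Nat.sub_sub_self hi] using hW (τ - i) (Nat.sub_le _ _)
  rw [Nat.sub_self] at hmem
  exact (Set.eq_empty_iff_forall_notMem.mp h) _ ⟨hmem, hf0⟩

/-- if `h_S(G) > k` (with `k ≥ 1`), then any strategy using `k` hunters,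
against a rabbit that may start anywhere, never decontaminates `S`:
`R_τ ∩ S ≠ ∅` for every `τ ≥ 1`. -/
theorem no_decontamination_of_S {V : Type*} [Fintype V]
    (adj : V → V → Prop) (hsymm : Symmetric adj) (hniso : ∀ v, ∃ u, adj v u)
    (S : Set V) (k : ℕ) (hk : 1 ≤ k) (h : k < huntingNumberFrom adj S)
    (W : ℕ → Set V) (hW : UsesAtMost W k) :
    ∀ τ : ℕ, (terr adj Set.univ W τ ∩ S).Nonempty := by
  intro τ
  by_contra hne
  exact Nat.notMem_of_lt_sInf h ⟨fun t => W (τ - t), fun t => hW _, τ,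
    terr_reverse_eq_empty hsymm (Set.not_nonempty_iff_eq_empty.mp hne)⟩
end

section
/- Let G = (V,E) be a finite undirected graph, possibly containing loops, with no isolated vertices, and let B_G be its bipartite double cover: V(B_G) = V ∪ V' where V' is a disjoint copy of V, and for every edge vw ∈ E (including loops, where v = w), B_G contains the edges v'w and w'v. Then h(G) = h(B_G). -/
/-- The bipartite double cover `B_G` of a graph (with loops) `G`:
vertex set `V ⊕ V` (the right summand is the copy `V'`), with edges `v'w` and `w'v`
for every edge `vw` of `G`. -/
def adjB {V : Type*} (adj : V → V → Prop) : V ⊕ V → V ⊕ V → Prop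
  | Sum.inl v, Sum.inr w => adj v w
  | Sum.inr v, Sum.inl w => adj v w
  | Sum.inl _, Sum.inl _ => False
  | Sum.inr _, Sum.inr _ => False

/-- The copy of `v` in the double cover on the side occupied at time `t` by a rabbit
which starts in the left part. -/
def coverSide {V : Type*} (t : ℕ) (v : V) : V ⊕ V :=
  if Even t then Sum.inl v else Sum.inr v

theorem coverSide_injective {V : Type*} (t : ℕ) :
    Function.Injective (coverSide t : V → V ⊕ V) := by
  intro u v h
  unfold coverSide at h
  split_ifs at h <;> simpa using h

theorem exists_eq_coverSide {V : Type*} (t : ℕ) (x : V ⊕ V) :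
    ∃ v, x = coverSide t v ∨ x = coverSide (t + 1) v := by
  by_cases ht : Even t <;> rcases x with v | v <;> exact ⟨v, by simp [coverSide, ht, Nat.even_add_one]⟩

theorem adjB_coverSide_succ {V : Type*} {adj : V → V → Prop} (t : ℕ) (x : V ⊕ V) (v : V) :
    adjB adj x (coverSide (t + 1) v) ↔ ∃ u, x = coverSide t u ∧ adj u v := by
  by_cases ht : Even t <;> rcases x with w | w <;>
    simp [coverSide, adjB, ht, Nat.even_add_one]

theorem coverSide_mem_terr {V : Type*} {adj : V → V → Prop} (W : ℕ → Set (V ⊕ V)) (t : ℕ) :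
    ∀ v, v ∈ terr adj Set.univ (fun s => coverSide s ⁻¹' W s) t →
      coverSide t v ∈ terr (adjB adj) Set.univ W t := by
  induction t with
  | zero => intro v hv; exact hv
  | succ t ih =>
    rintro v ⟨⟨u, hu, huv⟩, hv⟩
    exact ⟨⟨coverSide t u, ih u hu, (adjB_coverSide_succ t _ v).2 ⟨u, rfl, huv⟩⟩, hv⟩

/-- Play `W` against the rabbits starting in the left part up to time `T`, and then `W` again
against the rabbits starting in the right part. -/
def coverStrategy {V : Type*} (W : ℕ → Set V) (T t : ℕ) : Set (V ⊕ V) :=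
  if t ≤ T then coverSide t '' W t else coverSide (t + 1) '' W (t - (T + 1))

theorem mem_terr_of_coverSide_mem {V : Type*} {adj : V → V → Prop} (W : ℕ → Set V)
    {T t : ℕ} (ht : t ≤ T) :
    ∀ v, coverSide t v ∈ terr (adjB adj) Set.univ (coverStrategy W T) t →
      v ∈ terr adj Set.univ W t := by
  induction t with
  | zero =>
    rintro v ⟨-, hv⟩
    exact ⟨trivial, fun h => hv (by simpa [coverStrategy] using ⟨v, h, rfl⟩)⟩
  | succ t ih =>
    rintro v ⟨⟨x, hx, hxv⟩, hv⟩
    obtain ⟨u, rfl, huv⟩ := (adjB_coverSide_succ t _ v).1 hxv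
    refine ⟨⟨u, ih (by omega) u hx, huv⟩, fun h => hv ?_⟩
    rw [coverStrategy, if_pos ht]
    exact ⟨v, h, rfl⟩

theorem coverSide_notMem_terr_add {V : Type*} {adj : V → V → Prop} {W : ℕ → Set (V ⊕ V)}
    {T : ℕ} (hT : ∀ v, coverSide T v ∉ terr (adjB adj) Set.univ W T) (s : ℕ) :
    ∀ v, coverSide (T + s) v ∉ terr (adjB adj) Set.univ W (T + s) := by
  induction s with
  | zero => exact hT
  | succ s ih =>
    rintro v ⟨⟨x, hx, hxv⟩, -⟩
    obtain ⟨u, rfl, -⟩ := (adjB_coverSide_succ (T + s) _ v).1 hxv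
    exact ih u hx

theorem mem_terr_of_coverSide_succ_mem {V : Type*} {adj : V → V → Prop} (W : ℕ → Set V)
    (T s : ℕ) :
    ∀ v, coverSide (T + 1 + s + 1) v ∈
        terr (adjB adj) Set.univ (coverStrategy W T) (T + 1 + s) →
      v ∈ terr adj Set.univ W s := by
  have key : ∀ s v, v ∈ W s →
      coverSide (T + 1 + s + 1) v ∈ coverStrategy W T (T + 1 + s) := by
    intro s v h
    rw [coverStrategy, if_neg (by omega), Nat.add_sub_cancel_left]
    exact ⟨v, h, rfl⟩
  induction s with
  | zero =>
    rintro v ⟨-, hv⟩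
    exact ⟨trivial, fun h => hv (key 0 v h)⟩
  | succ s ih =>
    rintro v ⟨⟨x, hx, hxv⟩, hv⟩
    obtain ⟨u, rfl, huv⟩ := (adjB_coverSide_succ (T + 1 + s + 1) _ v).1 hxv
    exact ⟨⟨u, ih u hx, huv⟩, fun h => hv (key (s + 1) v h)⟩

theorem terr_coverStrategy_eq_empty {V : Type*} {adj : V → V → Prop} {W : ℕ → Set V} {T : ℕ}
    (hT : terr adj Set.univ W T = ∅) :
    terr (adjB adj) Set.univ (coverStrategy W T) (T + 1 + T) = ∅ := by
  refine Set.eq_empty_of_forall_notMem fun x hx => ?_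
  obtain ⟨v, rfl | rfl⟩ := exists_eq_coverSide (T + 1 + T) x
  · have h := coverSide_notMem_terr_add (adj := adj) (W := coverStrategy W T) (T := T)
      (fun v hv => by simpa [hT] using mem_terr_of_coverSide_mem W le_rfl v hv) (1 + T) v
    rw [← add_assoc] at h
    exact h hx
  · simpa [hT] using mem_terr_of_coverSide_succ_mem W T T v hx

/-- `h(G) = h(B_G)`. -/
theorem hunting_number_double_cover {V : Type*} [Fintype V]
    (adj : V → V → Prop) (hsymm : Symmetric adj) (hniso : ∀ v, ∃ u, adj v u) :
    huntingNumber adj = huntingNumber (adjB adj) := by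
  unfold huntingNumber huntingNumberFrom
  congr 1
  ext k
  constructor
  · rintro ⟨W, hW, T, hT⟩
    refine ⟨coverStrategy W T, fun t => ?_, T + 1 + T, terr_coverStrategy_eq_empty hT⟩
    unfold coverStrategy
    split_ifs
    · exact (Set.ncard_image_le (Set.toFinite _)).trans (hW _)
    · exact (Set.ncard_image_le (Set.toFinite _)).trans (hW _)
  · rintro ⟨W, hW, T, hT⟩
    refine ⟨fun s => coverSide s ⁻¹' W s, fun t => ?_, T, ?_⟩
    · exact (Set.ncard_le_ncard_of_injOn (coverSide t) (fun _ h => h)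
        (coverSide_injective t).injOn (Set.toFinite _)).trans (hW t)
    · refine Set.eq_empty_of_forall_notMem fun v hv => ?_
      simpa [hT] using coverSide_mem_terr W T v hv
end

section
/- Let G = (V,E) be a finite undirected graph with no isolated vertices and let p ≥ 2 be an integer. Let C_G^p be the graph with vertex set consisting of p disjoint copies V^1, ..., V^p of V, where for every edge vw ∈ E the graph C_G^p contains the edges v^i w^j for all 1 ≤ i, j ≤ p. Then h(C_G^p) = p · h(G). -/
/-- The set of vertices all of whose copies lie in `A`. -/
def fullFibers {V ι : Type*} (A : Set (V × ι)) : Set V :=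
  {v | ∀ i, (v, i) ∈ A}

theorem fullFibers_preimage_fst {V ι : Type*} [Nonempty ι] (A : Set V) :
    fullFibers (Prod.fst ⁻¹' A : Set (V × ι)) = A := by
  ext v
  simp [fullFibers]

theorem image_fst_preimage_fst_diff {V ι : Type*} (A : Set V) (B : Set (V × ι)) :
    Prod.fst '' (Prod.fst ⁻¹' A \ B) = A \ fullFibers B := by
  ext v
  simp [fullFibers]

theorem nbhd_blowup {V ι : Type*} (adj : V → V → Prop) (A : Set (V × ι)) :
    nbhd (fun a b : V × ι => adj a.1 b.1) A = Prod.fst ⁻¹' nbhd adj (Prod.fst '' A) := by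
  ext v
  simp [nbhd]

/-- The territory in the blow-up projects to the territory in the base graph, where a vertex
counts as shot when all of its copies are. -/
theorem image_fst_terr_blowup {V ι : Type*} (adj : V → V → Prop) (S : Set V)
    (W : ℕ → Set (V × ι)) (t : ℕ) :
    Prod.fst '' terr (fun a b : V × ι => adj a.1 b.1) (Prod.fst ⁻¹' S) W t =
      terr adj S (fun t => fullFibers (W t)) t := by
  induction t with
  | zero => exact image_fst_preimage_fst_diff S (W 0)
  | succ t ih => rw [terr, terr, nbhd_blowup, image_fst_preimage_fst_diff, ih]

theorem terr_blowup_eq_empty_iff {V ι : Type*} (adj : V → V → Prop)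
    (W : ℕ → Set (V × ι)) (t : ℕ) :
    terr (fun a b : V × ι => adj a.1 b.1) Set.univ W t = ∅ ↔
      terr adj Set.univ (fun t => fullFibers (W t)) t = ∅ := by
  rw [← image_fst_terr_blowup, Set.image_eq_empty, Set.preimage_univ]

theorem ncard_preimage_fst {V : Type*} (p : ℕ) (A : Set V) :
    (Prod.fst ⁻¹' A : Set (V × Fin p)).ncard = p * A.ncard := by
  rw [← Set.prod_univ, Set.ncard_prod, Set.ncard_univ, Nat.card_fin, mul_comm]

theorem mul_ncard_fullFibers_le {V : Type*} [Finite V] {p : ℕ} (A : Set (V × Fin p)) :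
    p * (fullFibers A).ncard ≤ A.ncard := by
  rw [← ncard_preimage_fst]
  exact Set.ncard_le_ncard fun a ha => ha a.2

theorem exists_optimal_strategy {V : Type*} [Finite V] (adj : V → V → Prop) :
    ∃ W : ℕ → Set V, UsesAtMost W (huntingNumber adj) ∧ ∃ T, terr adj Set.univ W T = ∅ :=
  Nat.sInf_mem (s := {k | ∃ W : ℕ → Set V, UsesAtMost W k ∧ ∃ T, terr adj Set.univ W T = ∅})
    ⟨_, fun _ => Set.univ, fun _ => le_rfl, 0, Set.sdiff_self⟩

theorem huntingNumber_le {V : Type*} {adj : V → V → Prop} {W : ℕ → Set V} {k T : ℕ}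
    (hW : UsesAtMost W k) (hT : terr adj Set.univ W T = ∅) : huntingNumber adj ≤ k :=
  Nat.sInf_le ⟨W, hW, T, hT⟩

/-- for `p ≥ 2`, the graph `C_G^p` (the tensor product of `G` with the
complete graph with loops on `p` vertices, i.e. `p` copies of `V` with `v^i w^j` adjacent
iff `vw ∈ E`) satisfies `h(C_G^p) = p · h(G)`. -/
theorem hunting_number_blowup {V : Type*} [Fintype V]
    (adj : V → V → Prop) (hsymm : Symmetric adj) (hniso : ∀ v, ∃ u, adj v u)
    (p : ℕ) (hp : 2 ≤ p) :
    huntingNumber (fun a b : V × Fin p => adj a.1 b.1) = p * huntingNumber adj := by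
  have hp0 : 0 < p := by lia
  have : Nonempty (Fin p) := ⟨⟨0, hp0⟩⟩
  apply le_antisymm
  · obtain ⟨W, hW, T, hT⟩ := exists_optimal_strategy adj
    refine huntingNumber_le (W := fun t => Prod.fst ⁻¹' W t) (T := T) (fun t => ?_) ?_
    · rw [ncard_preimage_fst]
      exact Nat.mul_le_mul_left p (hW t)
    · simpa only [terr_blowup_eq_empty_iff, fullFibers_preimage_fst] using hT
  · obtain ⟨W, hW, T, hT⟩ := exists_optimal_strategy (fun a b : V × Fin p => adj a.1 b.1)
    rw [mul_comm, ← Nat.le_div_iff_mul_le hp0]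
    refine huntingNumber_le (fun t => ?_) ((terr_blowup_eq_empty_iff adj W T).1 hT)
    rw [Nat.le_div_iff_mul_le hp0, mul_comm]
    exact (mul_ncard_fullFibers_le (W t)).trans (hW t)
end

section
/- For integers a ≥ 1 and p ≥ 2, let G(a,p) be the graph obtained as the union of a complete graph with loops K°_{a+1} on a+1 vertices and a path v_1 v_2 ... v_p on p vertices whose first vertex v_1 belongs to the clique. Then h(G(a,p)) = a + 1, and moreover, if 2 ≤ p ≤ a, then h( G(a,p) ∇ G(a,p) ) = 2a + 2, where G(a,p) ∇ G(a,p) is the join of two disjoint copies of G(a,p). -/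
/-- The join `G ∇ H` of two graphs: disjoint union plus all edges between the two sides. -/
def adjJoin {V U : Type*} (adjG : V → V → Prop) (adjH : U → U → Prop) :
    V ⊕ U → V ⊕ U → Prop
  | Sum.inl a, Sum.inl b => adjG a b
  | Sum.inr a, Sum.inr b => adjH a b
  | Sum.inl _, Sum.inr _ => True
  | Sum.inr _, Sum.inl _ => True

/-- The graph `G(a,p)` on `a + p` vertices: vertices `0, …, a` form a complete graph
with loops `K°_{a+1}`, and vertices `a, a+1, …, a+p-1` form a path `v_1 … v_p`
whose first vertex `v_1` (the vertex `a`) belongs to the clique. -/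
def adjGap (a p : ℕ) : Fin (a + p) → Fin (a + p) → Prop := fun i j =>
  ((i : ℕ) ≤ a ∧ (j : ℕ) ≤ a) ∨
  ((i : ℕ) + 1 = (j : ℕ) ∧ a ≤ (i : ℕ)) ∨
  ((j : ℕ) + 1 = (i : ℕ) ∧ a ≤ (j : ℕ))

/-- A winning strategy needs at least as many hunters as any complete looped subgraph
has vertices. -/
theorem ncard_le_of_terr_eq_empty {V : Type*} [Finite V] {adj : V → V → Prop} {C : Set V}
    (hC : ∀ u ∈ C, ∀ v ∈ C, adj u v) {W : ℕ → Set V} {k : ℕ} (hW : UsesAtMost W k)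
    {T : ℕ} (hT : terr adj Set.univ W T = ∅) : C.ncard ≤ k := by
  by_contra! hk
  have escape (t : ℕ) : ∃ v ∈ C, v ∉ W t :=
    Set.exists_mem_notMem_of_ncard_lt_ncard ((hW t).trans_lt hk)
  have survive (t : ℕ) : ∃ v ∈ C, v ∈ terr adj Set.univ W t := by
    induction t with
    | zero =>
      obtain ⟨v, hv, hvW⟩ := escape 0
      exact ⟨v, hv, trivial, hvW⟩
    | succ t ih =>
      obtain ⟨u, hu, huR⟩ := ih
      obtain ⟨v, hv, hvW⟩ := escape (t + 1)
      exact ⟨v, hv, ⟨u, huR, hC u hu v hv⟩, hvW⟩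
  obtain ⟨v, -, hv⟩ := survive T
  simp [hT] at hv

/-- A complete looped subgraph and a winning strategy of the same size determine the
hunting number. -/
theorem huntingNumber_eq_of_clique {V : Type*} [Finite V] {adj : V → V → Prop} {C : Set V}
    (hC : ∀ u ∈ C, ∀ v ∈ C, adj u v) {W : ℕ → Set V} (hW : UsesAtMost W C.ncard)
    {T : ℕ} (hT : terr adj Set.univ W T = ∅) : huntingNumber adj = C.ncard := by
  refine le_antisymm (Nat.sInf_le ⟨W, hW, T, hT⟩) (le_csInf ⟨_, W, hW, T, hT⟩ ?_)
  rintro k ⟨W', hW', T', hT'⟩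
  exact ncard_le_of_terr_eq_empty hC hW' hT'

theorem ncard_fin_val_le {n a : ℕ} (h : a < n) : {i : Fin n | (i : ℕ) ≤ a}.ncard = a + 1 := by
  have : {i : Fin n | (i : ℕ) ≤ a} = (Finset.Iic (⟨a, h⟩ : Fin n) : Set (Fin n)) := by
    ext i
    simp [Fin.le_def]
  rw [this, Set.ncard_coe_finset, Fin.card_Iic]

theorem ncard_fin_pair_le (n c d : ℕ) : {i : Fin n | (i : ℕ) = c ∨ (i : ℕ) = d}.ncard ≤ 2 := by
  rw [← Set.ncard_image_of_injective _ Fin.val_injective]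
  refine (Set.ncard_le_ncard (t := {c, d}) ?_ (by simp)).trans (Set.ncard_insert_le c {d} |>.trans (by simp))
  rintro _ ⟨i, hi, rfl⟩
  exact hi

theorem ncard_inl_union_inr {V U : Type*} [Finite V] [Finite U] (A : Set V) (B : Set U) :
    (Sum.inl '' A ∪ Sum.inr '' B : Set (V ⊕ U)).ncard = A.ncard + B.ncard := by
  rw [Set.ncard_union_eq Set.disjoint_image_inl_image_inr,
    Set.ncard_image_of_injective _ Sum.inl_injective,
    Set.ncard_image_of_injective _ Sum.inr_injective]

/-- Shoot the clique, then sweep the path with two hunters, moving away from the clique. -/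
def sweepGap (a p : ℕ) : ℕ → Set (Fin (a + p))
  | 0 => {i | (i : ℕ) ≤ a}
  | t + 1 => {i | (i : ℕ) = a + t ∨ (i : ℕ) = a + t + 1}

theorem lt_of_mem_terr_sweepGap (a p t : ℕ) :
    ∀ i ∈ terr (adjGap a p) Set.univ (sweepGap a p) t, a + t < (i : ℕ) := by
  induction t with
  | zero =>
    rintro i ⟨-, hi⟩
    simpa [sweepGap] using hi
  | succ t ih =>
    rintro i ⟨⟨j, hj, hji⟩, hi⟩
    have := ih j hj
    simp only [sweepGap, Set.mem_ofPred_eq] at hi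
    simp only [adjGap] at hji
    omega

theorem huntingNumber_adjGap {a p : ℕ} (ha : 1 ≤ a) (hp : 1 ≤ p) :
    huntingNumber (adjGap a p) = a + 1 := by
  have hcard := ncard_fin_val_le (n := a + p) (a := a) (by omega)
  rw [← hcard]
  refine huntingNumber_eq_of_clique (W := sweepGap a p) (T := p)
    (fun u hu v hv => Or.inl ⟨hu, hv⟩) ?_ ?_
  · rw [hcard]
    rintro (_ | t)
    · exact hcard.le
    · exact (ncard_fin_pair_le _ _ _).trans (by omega)
  · refine Set.eq_empty_of_forall_notMem fun i hi => ?_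
    have := lt_of_mem_terr_sweepGap a p p i hi
    omega

/-- Occupy the left side while sweeping the right path towards its clique; then shoot both
cliques; then occupy the right side while sweeping the left path away from its clique. -/
def sweepJoin (a p t : ℕ) : Set (Fin (a + p) ⊕ Fin (a + p)) :=
  if t + 1 < p then
    Sum.inl '' Set.univ ∪
      Sum.inr '' {i | (i : ℕ) = a + p - (t + 1) ∨ (i : ℕ) = a + p - (t + 2)}
  else if t + 1 = p then
    Sum.inl '' {i | (i : ℕ) ≤ a} ∪ Sum.inr '' {i | (i : ℕ) ≤ a}
  else
    Sum.inl '' {i | (i : ℕ) = a + t - p ∨ (i : ℕ) = a + t + 1 - p} ∪ Sum.inr '' Set.univ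

theorem usesAtMost_sweepJoin {a p : ℕ} (hp : 1 ≤ p) (hpa : p ≤ a) :
    UsesAtMost (sweepJoin a p) (2 * a + 2) := by
  intro t
  have hcard := ncard_fin_val_le (n := a + p) (a := a) (by omega)
  have hleft := ncard_fin_pair_le (a + p) (a + t - p) (a + t + 1 - p)
  have hright := ncard_fin_pair_le (a + p) (a + p - (t + 1)) (a + p - (t + 2))
  unfold sweepJoin
  split_ifs <;> rw [ncard_inl_union_inr] <;> try rw [Set.ncard_univ, Nat.card_fin]
  all_goals omega

theorem mem_terr_sweepJoin {a p : ℕ} (hp : 2 ≤ p) (t : ℕ) :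
    ∀ x ∈ terr (adjJoin (adjGap a p) (adjGap a p)) Set.univ (sweepJoin a p) t,
      Sum.elim (fun i : Fin (a + p) => p ≤ t + 1 ∧ a + t + 2 ≤ (i : ℕ) + p)
        (fun j : Fin (a + p) => t + 2 ≤ p ∧ (j : ℕ) + t + 2 < a + p) x := by
  induction t with
  | zero =>
    rintro (i | i) ⟨-, hi⟩ <;> have := i.isLt <;>
      simp [sweepJoin, show 1 < p by omega] at hi ⊢
    omega
  | succ t ih =>
    rintro (i | i) ⟨⟨j | j, hj, hji⟩, hi⟩ <;> have := i.isLt <;> have := ih _ hj <;>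
      unfold sweepJoin at hi <;> split_ifs at hi <;>
      simp [adjJoin, adjGap] at * <;> omega

theorem huntingNumber_adjJoin_adjGap {a p : ℕ} (hp : 2 ≤ p) (hpa : p ≤ a) :
    huntingNumber (adjJoin (adjGap a p) (adjGap a p)) = 2 * a + 2 := by
  have hcard : (Sum.inl '' {i : Fin (a + p) | (i : ℕ) ≤ a} ∪
      Sum.inr '' {i : Fin (a + p) | (i : ℕ) ≤ a} : Set _).ncard = 2 * a + 2 := by
    rw [ncard_inl_union_inr, ncard_fin_val_le (by omega)]
    ring
  rw [← hcard]
  refine huntingNumber_eq_of_clique (W := sweepJoin a p) (T := 2 * p) ?_ ?_ ?_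
  · rintro _ (⟨i, hi, rfl⟩ | ⟨i, hi, rfl⟩) _ (⟨j, hj, rfl⟩ | ⟨j, hj, rfl⟩)
    · exact Or.inl ⟨hi, hj⟩
    · trivial
    · trivial
    · exact Or.inl ⟨hi, hj⟩
  · rw [hcard]
    exact usesAtMost_sweepJoin (by omega) hpa
  · refine Set.eq_empty_of_forall_notMem fun x hx => ?_
    have := mem_terr_sweepJoin hp _ x hx
    rcases x with i | i <;> simp only [Sum.elim_inl, Sum.elim_inr] at this <;> omega

/-- for `a ≥ 1` and `p ≥ 2`, `h(G(a,p)) = a + 1`, and if moreover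
`p ≤ a` then `h(G(a,p) ∇ G(a,p)) = 2a + 2`. -/
theorem hunting_number_Gap (a p : ℕ) (ha : 1 ≤ a) (hp : 2 ≤ p) :
    huntingNumber (adjGap a p) = a + 1 ∧
    (p ≤ a → huntingNumber (adjJoin (adjGap a p) (adjGap a p)) = 2 * a + 2) :=
  ⟨huntingNumber_adjGap ha (by omega), huntingNumber_adjJoin_adjGap hp⟩
end

section
/- Let G = (V,E) be a finite undirected simple graph with no isolated vertices, let S' ⊆ V, k an integer with 1 ≤ k ≤ |S'|, and n = |V|. Build a graph H (with loops) containing G as a subgraph together with three complete-with-loops subgraphs on disjoint vertex sets A, B, C with |A| = n − k, |B| = k, |C| = 2k, where A is fully connected to B, to C, and to S', and B is fully connected to V. Then h_{S'}(G) ≤ k if and only if h(H) = n + k. -/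
/-- The graph `H` built from a simple graph `G` on `n` vertices and a start set `S'`:
`H` contains `G` together with three complete-with-loops subgraphs on
`A = Fin (n-k)`, `B = Fin k`, `C = Fin (2k)`; `A` is fully connected to `B`, `C`
and `S'`, and `B` is fully connected to `V`. -/
def adjH {V : Type*} (G : SimpleGraph V) (S' : Set V) (n k : ℕ) :
    V ⊕ (Fin (n - k) ⊕ (Fin k ⊕ Fin (2 * k))) →
      V ⊕ (Fin (n - k) ⊕ (Fin k ⊕ Fin (2 * k))) → Prop
  | Sum.inl v, Sum.inl w => G.Adj v w
  -- V – A : exactly the vertices of S' are adjacent to A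
  | Sum.inl v, Sum.inr (Sum.inl _) => v ∈ S'
  | Sum.inr (Sum.inl _), Sum.inl v => v ∈ S'
  -- V – B : fully connected
  | Sum.inl _, Sum.inr (Sum.inr (Sum.inl _)) => True
  | Sum.inr (Sum.inr (Sum.inl _)), Sum.inl _ => True
  -- V – C : no edges
  | Sum.inl _, Sum.inr (Sum.inr (Sum.inr _)) => False
  | Sum.inr (Sum.inr (Sum.inr _)), Sum.inl _ => False
  -- A is a clique with loops, fully connected to B and C
  | Sum.inr (Sum.inl _), Sum.inr _ => True
  | Sum.inr (Sum.inr _), Sum.inr (Sum.inl _) => True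
  -- B is a clique with loops
  | Sum.inr (Sum.inr (Sum.inl _)), Sum.inr (Sum.inr (Sum.inl _)) => True
  -- B – C : no edges
  | Sum.inr (Sum.inr (Sum.inl _)), Sum.inr (Sum.inr (Sum.inr _)) => False
  | Sum.inr (Sum.inr (Sum.inr _)), Sum.inr (Sum.inr (Sum.inl _)) => False
  -- C is a clique with loops
  | Sum.inr (Sum.inr (Sum.inr _)), Sum.inr (Sum.inr (Sum.inr _)) => True

theorem terr_congr {V : Type*} {adj : V → V → Prop} {S : Set V} {W W' : ℕ → Set V} (t : ℕ)
    (h : ∀ i ≤ t, W i = W' i) : terr adj S W t = terr adj S W' t := by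
  induction t with
  | zero => simp [terr, h]
  | succ t ih => simp only [terr, h (t + 1) le_rfl, ih fun i hi => h i (hi.trans t.le_succ)]

theorem huntingNumberFrom_le_iff {V : Type*} [Finite V] {adj : V → V → Prop} {S : Set V} {k : ℕ} :
    huntingNumberFrom adj S ≤ k ↔
      ∃ W : ℕ → Set V, UsesAtMost W k ∧ ∃ T, terr adj S W T = ∅ := by
  refine ⟨fun h => ?_, fun h => Nat.sInf_le h⟩
  have hne : {k | ∃ W : ℕ → Set V, UsesAtMost W k ∧ ∃ T, terr adj S W T = ∅}.Nonempty :=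
    ⟨Nat.card V, fun _ => Set.univ, fun _ => (Set.ncard_univ V).le, 0, by simp [terr]⟩
  obtain ⟨W, hW, hT⟩ := Nat.sInf_mem hne
  exact ⟨W, fun t => (hW t).trans h, hT⟩

/-- The territory consists of the endpoints of the walks that avoid all shots. -/
theorem mem_terr_iff_exists_walk {V : Type*} {adj : V → V → Prop} {S : Set V} {W : ℕ → Set V}
    {t : ℕ} {v : V} :
    v ∈ terr adj S W t ↔ ∃ f : ℕ → V, f 0 ∈ S ∧ f t = v ∧
      (∀ i < t, adj (f i) (f (i + 1))) ∧ ∀ i ≤ t, f i ∉ W i := by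
  induction t generalizing v with
  | zero =>
    constructor
    · rintro ⟨hS, hW⟩
      exact ⟨fun _ => v, hS, rfl, by simp, by simpa using hW⟩
    · rintro ⟨f, hS, rfl, -, hW⟩
      exact ⟨hS, hW 0 le_rfl⟩
  | succ t ih =>
    constructor
    · rintro ⟨⟨u, hu, huv⟩, hW⟩
      obtain ⟨f, h0, rfl, hadj, hf⟩ := ih.1 hu
      refine ⟨fun i => if i ≤ t then f i else v, by simpa using h0, by simp, fun i hi => ?_,
        fun i hi => ?_⟩
      · rcases Nat.lt_succ_iff_lt_or_eq.1 hi with h | rfl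
        · simpa [h.le, Nat.succ_le_of_lt h] using hadj i h
        · simpa using huv
      · rcases Nat.le_succ_iff.1 hi with h | rfl
        · simpa [h] using hf i h
        · simpa using hW
    · rintro ⟨f, h0, rfl, hadj, hf⟩
      exact ⟨⟨f t, ih.2 ⟨f, h0, rfl, fun i hi => hadj i (by omega), fun i hi => hf i (by omega)⟩,
        hadj t (by omega)⟩, hf _ le_rfl⟩

/-- Reversing time exchanges the start set with the set in which the rabbit must end. -/
theorem terr_reverse_inter_eq_empty {V : Type*} {adj : V → V → Prop}
    (hsymm : ∀ u v, adj u v → adj v u) {S S' : Set V} {W : ℕ → Set V} {t : ℕ}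
    (h : terr adj S W t ∩ S' = ∅) : terr adj S' (fun i => W (t - i)) t ∩ S = ∅ := by
  refine Set.eq_empty_of_forall_notMem ?_
  rintro _ ⟨hv, hS⟩
  obtain ⟨f, h0, rfl, hadj, hf⟩ := mem_terr_iff_exists_walk.1 hv
  refine Set.eq_empty_iff_forall_notMem.1 h (f 0) ⟨mem_terr_iff_exists_walk.2
    ⟨fun i => f (t - i), by simpa using hS, by simp, fun i hi => ?_, fun i hi => ?_⟩, h0⟩
  · have := hadj (t - (i + 1)) (by omega)
    rw [show t - (i + 1) + 1 = t - i by omega] at this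
    exact hsymm _ _ this
  · have := hf (t - i) (by omega)
    rwa [show t - (t - i) = i by omega] at this

/-- `X` contains the territory after some number of rounds against some strategy with
`k` hunters. -/
def ContainsReachable {V : Type*} (adj : V → V → Prop) (S : Set V) (k : ℕ) (X : Set V) : Prop :=
  ∃ W : ℕ → Set V, UsesAtMost W k ∧ ∃ t, terr adj S W t ⊆ X

theorem ContainsReachable.start {V : Type*} {adj : V → V → Prop} {S : Set V} {k : ℕ} {U X : Set V}
    (hU : U.ncard ≤ k) (h : S \ U ⊆ X) : ContainsReachable adj S k X :=
  ⟨fun _ => U, fun _ => hU, 0, h⟩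

theorem ContainsReachable.step {V : Type*} {adj : V → V → Prop} {S : Set V} {k : ℕ} {U X Y : Set V}
    (hX : ContainsReachable adj S k X) (hU : U.ncard ≤ k) (h : nbhd adj X \ U ⊆ Y) :
    ContainsReachable adj S k Y := by
  obtain ⟨W, hW, t, ht⟩ := hX
  refine ⟨Function.update W (t + 1) U, fun i => ?_, t + 1, ?_⟩
  · rcases eq_or_ne i (t + 1) with rfl | hi
    · simpa using hU
    · simpa [hi] using hW i
  · rintro v ⟨⟨u, hu, huv⟩, hv⟩
    rw [terr_congr (W' := W) t fun i hi =>
      Function.update_of_ne (by omega) _ _] at hu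
    exact h ⟨⟨u, ht hu, huv⟩, by simpa using hv⟩

theorem Set.ncard_eq_ncard_preimage_inl_add_inr {α β : Type*} [Finite α] [Finite β]
    (s : Set (α ⊕ β)) :
    s.ncard = (Sum.inl ⁻¹' s).ncard + (Sum.inr ⁻¹' s).ncard := by
  conv_lhs => rw [← Set.image_preimage_inl_union_image_preimage_inr s]
  rw [Set.ncard_union_eq, Set.ncard_image_of_injective _ Sum.inl_injective,
    Set.ncard_image_of_injective _ Sum.inr_injective]
  rw [Set.disjoint_left]
  rintro _ ⟨x, -, rfl⟩ ⟨y, -, h⟩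
  cases h

/-- The union of `U ⊆ V` and of those of the blocks `A`, `B`, `C` selected by `P`, `Q`, `R`. -/
def blockSet {V A B C : Type*} (U : Set V) (P Q R : Prop) : Set (V ⊕ (A ⊕ (B ⊕ C))) :=
  {x | Sum.elim (fun v => v ∈ U)
    (Sum.elim (fun _ => P) (Sum.elim (fun _ => Q) fun _ => R)) x}

theorem ncard_blocks {V A B C : Type*} [Finite V] [Finite A] [Finite B] [Finite C]
    (s : Set (V ⊕ (A ⊕ (B ⊕ C)))) :
    s.ncard = {v | Sum.inl v ∈ s}.ncard + ({a | Sum.inr (Sum.inl a) ∈ s}.ncard +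
      ({b | Sum.inr (Sum.inr (Sum.inl b)) ∈ s}.ncard +
        {c | Sum.inr (Sum.inr (Sum.inr c)) ∈ s}.ncard)) := by
  rw [s.ncard_eq_ncard_preimage_inl_add_inr,
    (Sum.inr ⁻¹' s).ncard_eq_ncard_preimage_inl_add_inr,
    (Sum.inr ⁻¹' (Sum.inr ⁻¹' s)).ncard_eq_ncard_preimage_inl_add_inr]
  rfl

theorem ncard_setOf_fin_of_forall {m : ℕ} {p : Fin m → Prop} (h : ∀ i, p i) :
    {i | p i}.ncard = m := by
  simp [h, Set.ncard_univ]

/-- The looped clique on `A ∪ C` cannot be cleared with fewer than `n + k` hunters. -/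
theorem le_huntingNumber_adjH {V : Type*} [Fintype V] (G : SimpleGraph V) (S' : Set V) (n k : ℕ)
    (hkn : k ≤ n) : n + k ≤ huntingNumber (adjH G S' n k) := by
  by_contra! hlt
  obtain ⟨W, hW, T, hT⟩ := huntingNumberFrom_le_iff.1 (Nat.le_sub_one_of_lt hlt)
  have hmiss : ∀ t, (∃ a, Sum.inr (Sum.inl a) ∉ W t) ∨
      ∃ c, Sum.inr (Sum.inr (Sum.inr c)) ∉ W t := by
    intro t
    by_contra! h
    have := hW t
    rw [ncard_blocks, ncard_setOf_fin_of_forall h.1, ncard_setOf_fin_of_forall h.2] at this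
    omega
  have hsurv : ∀ t, (∃ a, Sum.inr (Sum.inl a) ∈ terr (adjH G S' n k) Set.univ W t) ∨
      ∃ c, Sum.inr (Sum.inr (Sum.inr c)) ∈ terr (adjH G S' n k) Set.univ W t := by
    intro t
    induction t with
    | zero => exact (hmiss 0).imp (.imp fun a h => ⟨trivial, h⟩) (.imp fun c h => ⟨trivial, h⟩)
    | succ t ih =>
      rcases ih with ⟨x, hx⟩ | ⟨x, hx⟩ <;>
        exact (hmiss (t + 1)).imp (.imp fun a h => ⟨⟨_, hx, trivial⟩, h⟩)
          (.imp fun c h => ⟨⟨_, hx, trivial⟩, h⟩)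
  rcases hsurv T with ⟨x, hx⟩ | ⟨x, hx⟩ <;> simp [hT] at hx

theorem huntingNumber_adjH_le {V : Type*} [Fintype V] {G : SimpleGraph V} {S' : Set V} {k : ℕ}
    (hkn : k ≤ Fintype.card V) (h : huntingNumberFrom G.Adj S' ≤ k) :
    huntingNumber (adjH G S' (Fintype.card V) k) ≤ Fintype.card V + k := by
  obtain ⟨W, hW, T, hT⟩ := huntingNumberFrom_le_iff.1 h
  let W' : ℕ → Set (V ⊕ (Fin (Fintype.card V - k) ⊕ (Fin k ⊕ Fin (2 * k)))) := fun
    | 0 => blockSet Set.univ False True False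
    | t + 1 => if t ≤ T then blockSet (W t) True True False else blockSet ∅ True False True
  have hstep : ∀ t ≤ T, W' (t + 1) = blockSet (W t) True True False := fun t ht => if_pos ht
  refine huntingNumberFrom_le_iff.2 ⟨W', fun t => ?_, T + 2, ?_⟩
  · rcases t with _ | t
    · simp [W', blockSet, ncard_blocks, Set.ncard_univ]
    · have := hW t
      by_cases ht : t ≤ T <;> simp [W', ht, blockSet, ncard_blocks, Set.ncard_univ] <;> omega
  · have key : ∀ t ≤ T, terr (adjH G S' (Fintype.card V) k) Set.univ W' (t + 1) ⊆
        blockSet (terr G.Adj S' W t) False False True := by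
      intro t
      induction t with
      | zero =>
        rintro hle x ⟨⟨y, ⟨-, hy⟩, hadj⟩, hx⟩
        rw [hstep 0 hle] at hx
        rcases x with v | a | b | c <;> rcases y with v' | a' | b' | c' <;>
          simp_all [W', blockSet, adjH, terr]
      | succ t ih =>
        rintro hle x ⟨⟨y, hy, hadj⟩, hx⟩
        replace hy := ih (by omega) hy
        rw [hstep (t + 1) hle] at hx
        rcases x with v | a | b | c <;> rcases y with v' | a' | b' | c' <;>
          simp_all [blockSet, adjH]
        exact ⟨⟨v', hy, hadj⟩, hx⟩
    refine Set.eq_empty_of_forall_notMem ?_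
    rintro x ⟨⟨y, hy, hadj⟩, hx⟩
    replace hy := key T le_rfl hy
    rw [hT] at hy
    rcases x with v | a | b | c <;> rcases y with v' | a' | b' | c' <;>
      simp_all [W', blockSet, adjH]

theorem huntingNumberFrom_le_of_adjH {V : Type*} [Fintype V] {G : SimpleGraph V} {S' : Set V}
    {k : ℕ} (hk : 1 ≤ k) (hkn : k ≤ Fintype.card V)
    (h : huntingNumber (adjH G S' (Fintype.card V) k) ≤ Fintype.card V + k) :
    huntingNumberFrom G.Adj S' ≤ k := by
  by_contra hG
  rw [huntingNumberFrom_le_iff] at hG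
  have hS' : ∀ X, ContainsReachable G.Adj S' k X → X.Nonempty := by
    rintro X ⟨U, hU, t, ht⟩
    rw [Set.nonempty_iff_ne_empty]
    rintro rfl
    exact hG ⟨U, hU, t, Set.subset_empty_iff.1 ht⟩
  have huniv : ∀ X, ContainsReachable G.Adj Set.univ k X → (X ∩ S').Nonempty := by
    rintro X ⟨U, hU, t, ht⟩
    rw [Set.nonempty_iff_ne_empty]
    intro hX
    have := terr_reverse_inter_eq_empty (fun _ _ => G.adj_symm)
      (Set.subset_empty_iff.1 (hX ▸ Set.inter_subset_inter_left S' ht))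
    exact hG ⟨_, fun i => hU (t - i), t, by simpa using this⟩
  obtain ⟨W, hW, T, hT⟩ := huntingNumberFrom_le_iff.1 h
  have hcount : ∀ t, (∀ a, Sum.inr (Sum.inl a) ∈ W t) →
      (∀ b, Sum.inr (Sum.inr (Sum.inl b)) ∈ W t) →
      {v | Sum.inl v ∈ W t}.ncard ≤ k ∧ ∃ c, Sum.inr (Sum.inr (Sum.inr c)) ∉ W t := by
    intro t ha hb
    have := hW t
    rw [ncard_blocks, ncard_setOf_fin_of_forall ha, ncard_setOf_fin_of_forall hb] at this
    refine ⟨by omega, ?_⟩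
    by_contra! hc
    rw [ncard_setOf_fin_of_forall hc] at this
    omega
  have hsurv : ∀ t, ∃ R, R = terr (adjH G S' (Fintype.card V) k) Set.univ W t ∧
      ((∃ a, Sum.inr (Sum.inl a) ∈ R) ∨ (∃ b, Sum.inr (Sum.inr (Sum.inl b)) ∈ R) ∨
      ((∃ c, Sum.inr (Sum.inr (Sum.inr c)) ∈ R) ∧
        ContainsReachable G.Adj S' k {v | Sum.inl v ∈ R}) ∨
      ContainsReachable G.Adj Set.univ k {v | Sum.inl v ∈ R}) := by
    intro t
    refine ⟨_, rfl, ?_⟩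
    induction t with
    | zero =>
      by_cases ha : ∀ a, Sum.inr (Sum.inl a) ∈ W 0
      swap
      · push Not at ha
        exact .inl (ha.imp fun a h => ⟨trivial, h⟩)
      by_cases hb : ∀ b, Sum.inr (Sum.inr (Sum.inl b)) ∈ W 0
      swap
      · push Not at hb
        exact .inr (.inl (hb.imp fun b h => ⟨trivial, h⟩))
      exact .inr (.inr (.inr (.start (hcount 0 ha hb).1 fun v hv => ⟨trivial, hv.2⟩)))
    | succ t ih =>
      set R := terr (adjH G S' (Fintype.card V) k) Set.univ W t
      have hmem : ∀ x, (∃ y ∈ R, adjH G S' (Fintype.card V) k y x) → x ∉ W (t + 1) →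
          x ∈ terr (adjH G S' (Fintype.card V) k) Set.univ W (t + 1) :=
        fun x hx hxW => ⟨hx, hxW⟩
      have hA : ∀ a, ∃ y ∈ R, adjH G S' (Fintype.card V) k y (Sum.inr (Sum.inl a)) := by
        intro a
        rcases ih with ⟨x, hx⟩ | ⟨x, hx⟩ | ⟨⟨x, hx⟩, -⟩ | hX
        · exact ⟨_, hx, trivial⟩
        · exact ⟨_, hx, trivial⟩
        · exact ⟨_, hx, trivial⟩
        · obtain ⟨v, hv, hvS⟩ := huniv _ hX
          exact ⟨_, hv, hvS⟩
      have hB : ∀ b, ∃ y ∈ R, adjH G S' (Fintype.card V) k y (Sum.inr (Sum.inr (Sum.inl b))) := by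
        intro b
        rcases ih with ⟨x, hx⟩ | ⟨x, hx⟩ | ⟨-, hX⟩ | hX
        · exact ⟨_, hx, trivial⟩
        · exact ⟨_, hx, trivial⟩
        · obtain ⟨v, hv⟩ := hS' _ hX
          exact ⟨_, hv, trivial⟩
        · obtain ⟨v, hv, -⟩ := huniv _ hX
          exact ⟨_, hv, trivial⟩
      by_cases ha : ∀ a, Sum.inr (Sum.inl a) ∈ W (t + 1)
      swap
      · push Not at ha
        exact .inl (ha.imp fun a h => hmem _ (hA a) h)
      by_cases hb : ∀ b, Sum.inr (Sum.inr (Sum.inl b)) ∈ W (t + 1)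
      swap
      · push Not at hb
        exact .inr (.inl (hb.imp fun b h => hmem _ (hB b) h))
      obtain ⟨hU, c, hc⟩ := hcount (t + 1) ha hb
      right; right
      rcases ih with ⟨x, hx⟩ | ⟨x, hx⟩ | ⟨⟨x, hx⟩, hX⟩ | hX
      · exact .inl ⟨⟨c, hmem _ ⟨_, hx, trivial⟩ hc⟩,
          .start hU fun v hv => hmem _ ⟨_, hx, hv.1⟩ hv.2⟩
      · exact .inr (.start hU fun v hv => hmem _ ⟨_, hx, trivial⟩ hv.2)
      · refine .inl ⟨⟨c, hmem _ ⟨_, hx, trivial⟩ hc⟩, hX.step hU ?_⟩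
        rintro v ⟨⟨u, hu, huv⟩, hv⟩
        exact hmem _ ⟨_, hu, huv⟩ hv
      · refine .inr (hX.step hU ?_)
        rintro v ⟨⟨u, hu, huv⟩, hv⟩
        exact hmem _ ⟨_, hu, huv⟩ hv
  obtain ⟨R, hR, hcases⟩ := hsurv T
  rw [hT] at hR
  subst hR
  rcases hcases with ⟨x, hx⟩ | ⟨x, hx⟩ | ⟨⟨x, hx⟩, -⟩ | hX
  · exact hx
  · exact hx
  · exact hx
  · obtain ⟨v, hv, -⟩ := huniv _ hX
    exact hv

/-- with `n = |V|` and `1 ≤ k ≤ |S'|`,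
`h_{S'}(G) ≤ k` if and only if `h(H) = n + k`. -/
theorem restricted_hunting_iff_aux_graph {V : Type*} [Fintype V]
    (G : SimpleGraph V) (hniso : ∀ v, ∃ u, G.Adj v u)
    (S' : Set V) (k : ℕ) (hk1 : 1 ≤ k) (hk2 : k ≤ S'.ncard) :
    huntingNumberFrom G.Adj S' ≤ k ↔
      huntingNumber (adjH G S' (Fintype.card V) k) = Fintype.card V + k := by
  have hkn : k ≤ Fintype.card V :=
    hk2.trans ((Set.ncard_le_card S').trans_eq Nat.card_eq_fintype_card)
  have hlow := le_huntingNumber_adjH G S' (Fintype.card V) k hkn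
  exact ⟨fun h => (huntingNumber_adjH_le hkn h).antisymm hlow,
    fun h => huntingNumberFrom_le_of_adjH hk1 hkn h.le⟩
end

section
/- Let G = (V,E) be a finite undirected simple graph on n vertices with no isolated vertices. Then h(G,2) = (n + BSS(G))/2, where BSS(G) is the minimum value of |C| − |D| over all partitions (A, B, C, D) of V such that |A| = |B|, D is an independent set, N(D) ⊆ C, N(A) ⊆ A ∪ C, and N(B) ⊆ B ∪ C. -/
/-- The bisection stable separator number `BSS(G)`: the minimum of `|C| − |D|`
over partitions `(A,B,C,D)` of `V` with `|A| = |B|`, `D` an independent set,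
`N(D) ⊆ C`, `N(A) ⊆ A ∪ C` and `N(B) ⊆ B ∪ C`. -/
noncomputable def BSS {V : Type*} (G : SimpleGraph V) : ℤ :=
  sInf {z : ℤ | ∃ A B C D : Set V,
    A ∪ B ∪ C ∪ D = Set.univ ∧
    Disjoint A B ∧ Disjoint A C ∧ Disjoint A D ∧
    Disjoint B C ∧ Disjoint B D ∧ Disjoint C D ∧
    A.ncard = B.ncard ∧
    (∀ u ∈ D, ∀ v ∈ D, ¬ G.Adj u v) ∧
    nbhd G.Adj D ⊆ C ∧ nbhd G.Adj A ⊆ A ∪ C ∧ nbhd G.Adj B ⊆ B ∪ C ∧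
    z = (C.ncard : ℤ) - (D.ncard : ℤ)}

/-- Two rounds with `k` hunters suffice iff two vertex sets of size at most `k`
meet every edge in both of its orientations. -/
theorem exists_strategy_two_iff {V : Type*} (G : SimpleGraph V) (k : ℕ) :
    (∃ W : ℕ → Set V, UsesAtMost W k ∧ terr G.Adj Set.univ W (2 - 1) = ∅) ↔
      ∃ X Y : Set V, X.ncard ≤ k ∧ Y.ncard ≤ k ∧ ∀ u v, G.Adj u v → u ∈ X ∨ v ∈ Y := by
  constructor
  · rintro ⟨W, hW, h⟩
    refine ⟨W 0, W 1, hW 0, hW 1, fun u v huv => ?_⟩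
    by_contra! hc
    have hv : v ∈ terr G.Adj Set.univ W (2 - 1) := ⟨⟨u, ⟨Set.mem_univ u, hc.1⟩, huv⟩, hc.2⟩
    simp [h] at hv
  · rintro ⟨X, Y, hX, hY, h⟩
    refine ⟨fun t => if t = 0 then X else Y, fun t => ?_, ?_⟩
    · dsimp only
      split_ifs <;> assumption
    · rw [Set.eq_empty_iff_forall_notMem]
      rintro v ⟨⟨u, ⟨-, hu⟩, huv⟩, hv⟩
      exact (h u v huv).elim hu hv

/-- A partition into four parts, two of which have equal size `a`, has size
`2 * a + c + d`. -/
theorem card_eq_of_partition {V : Type*} [Fintype V] {A B C D : Set V}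
    (hun : A ∪ B ∪ C ∪ D = Set.univ) (hAB : Disjoint A B) (hAC : Disjoint A C)
    (hAD : Disjoint A D) (hBC : Disjoint B C) (hBD : Disjoint B D) (hCD : Disjoint C D) :
    Fintype.card V = A.ncard + B.ncard + C.ncard + D.ncard := by
  rw [← Set.ncard_union_eq hAB, ← Set.ncard_union_eq (hAC.union_left hBC),
    ← Set.ncard_union_eq ((hAD.union_left hBD).union_left hCD), hun, Set.ncard_univ,
    Nat.card_eq_fintype_card]

/-- The numbers over which `BSS G` minimizes are the numbers `2 * |X| - n` for pairs `X`, `Y` of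
equally large sets meeting every edge in both of its orientations. -/
theorem exists_partition_iff {V : Type*} [Fintype V] (G : SimpleGraph V) (z : ℤ) :
    (∃ A B C D : Set V,
      A ∪ B ∪ C ∪ D = Set.univ ∧
      Disjoint A B ∧ Disjoint A C ∧ Disjoint A D ∧
      Disjoint B C ∧ Disjoint B D ∧ Disjoint C D ∧
      A.ncard = B.ncard ∧
      (∀ u ∈ D, ∀ v ∈ D, ¬ G.Adj u v) ∧
      nbhd G.Adj D ⊆ C ∧ nbhd G.Adj A ⊆ A ∪ C ∧ nbhd G.Adj B ⊆ B ∪ C ∧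
      z = (C.ncard : ℤ) - (D.ncard : ℤ)) ↔
      ∃ X Y : Set V, X.ncard = Y.ncard ∧ (∀ u v, G.Adj u v → u ∈ X ∨ v ∈ Y) ∧
        z = 2 * (X.ncard : ℤ) - Fintype.card V := by
  constructor
  · rintro ⟨A, B, C, D, hun, hAB, hAC, hAD, hBC, hBD, hCD, hcard, -, hD, hA, hB, rfl⟩
    have hn := card_eq_of_partition hun hAB hAC hAD hBC hBD hCD
    have hX := Set.ncard_union_eq hAC
    have hY := Set.ncard_union_eq hBC
    refine ⟨A ∪ C, B ∪ C, by omega, fun u v huv => ?_, by omega⟩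
    have hu : u ∈ A ∪ B ∪ C ∪ D := hun ▸ Set.mem_univ u
    rcases hu with ((hu | hu) | hu) | hu
    · exact .inl (.inl hu)
    · exact .inr (hB ⟨u, hu, huv⟩)
    · exact .inl (.inr hu)
    · exact .inr (.inr (hD ⟨u, hu, huv⟩))
  · rintro ⟨X, Y, hcard, h, rfl⟩
    have hun : X \ Y ∪ Y \ X ∪ X ∩ Y ∪ (X ∪ Y)ᶜ = Set.univ := by
      ext v; simp; tauto
    have hAB : Disjoint (X \ Y) (Y \ X) := disjoint_sdiff_sdiff
    have hAC : Disjoint (X \ Y) (X ∩ Y) := by rw [Set.disjoint_left]; simp; tauto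
    have hAD : Disjoint (X \ Y) (X ∪ Y)ᶜ := by rw [Set.disjoint_left]; simp; tauto
    have hBC : Disjoint (Y \ X) (X ∩ Y) := by rw [Set.disjoint_left]; simp; tauto
    have hBD : Disjoint (Y \ X) (X ∪ Y)ᶜ := by rw [Set.disjoint_left]; simp; tauto
    have hCD : Disjoint (X ∩ Y) (X ∪ Y)ᶜ := by rw [Set.disjoint_left]; simp; tauto
    have hn := card_eq_of_partition hun hAB hAC hAD hBC hBD hCD
    have hX := Set.ncard_inter_add_ncard_sdiff_eq_ncard X Y
    have hY := Set.ncard_inter_add_ncard_sdiff_eq_ncard Y X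
    rw [Set.inter_comm] at hY
    refine ⟨X \ Y, Y \ X, X ∩ Y, (X ∪ Y)ᶜ, hun, hAB, hAC, hAD, hBC, hBD, hCD, by omega,
      ?_, ?_, ?_, ?_, by omega⟩
    · rintro u hu v hv huv
      exact (h u v huv).elim (fun hx => hu (.inl hx)) (fun hy => hv (.inr hy))
    all_goals
      rintro v ⟨u, hu, huv⟩
      have huv' := h u v huv
      have hvu' := h v u huv.symm
      simp at hu ⊢
      tauto

/-- `h(G,2) = (n + BSS(G)) / 2`, stated as `2 · h(G,2) = n + BSS(G)`. -/
theorem h2_eq_half_n_add_BSS {V : Type*} [Fintype V]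
    (G : SimpleGraph V) (hniso : ∀ v, ∃ u, G.Adj v u) :
    2 * (huntingNumberTL G.Adj 2 : ℤ) = (Fintype.card V : ℤ) + BSS G := by
  unfold huntingNumberTL BSS
  simp only [exists_strategy_two_iff, exists_partition_iff]
  set S := {k : ℕ | ∃ X Y : Set V, X.ncard ≤ k ∧ Y.ncard ≤ k ∧
    ∀ u v, G.Adj u v → u ∈ X ∨ v ∈ Y}
  set Z := {z : ℤ | ∃ X Y : Set V, X.ncard = Y.ncard ∧ (∀ u v, G.Adj u v → u ∈ X ∨ v ∈ Y) ∧
    z = 2 * (X.ncard : ℤ) - Fintype.card V}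
  have huniv : (Set.univ : Set V).ncard = Fintype.card V := by
    rw [Set.ncard_univ, Nat.card_eq_fintype_card]
  have hSmem : Fintype.card V ∈ S :=
    ⟨Set.univ, Set.univ, huniv.le, huniv.le, fun u _ _ => .inl (Set.mem_univ u)⟩
  have hZne : Z.Nonempty :=
    ⟨_, Set.univ, Set.univ, rfl, fun u _ _ => .inl (Set.mem_univ u), rfl⟩
  have hZbdd : BddBelow Z := by
    refine ⟨-Fintype.card V, ?_⟩
    rintro z ⟨X, Y, -, -, rfl⟩
    omega
  apply le_antisymm
  · obtain ⟨X, Y, hXY, h, hz⟩ := Int.csInf_mem hZne hZbdd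
    have hle : sInf S ≤ X.ncard := Nat.sInf_le ⟨X, Y, le_rfl, hXY.ge, h⟩
    omega
  · obtain ⟨X, Y, hX, hY, h⟩ := Nat.sInf_mem ⟨_, hSmem⟩
    have hpad (T : Set V) (hT : T.ncard ≤ sInf S) : ∃ T', T ⊆ T' ∧ T'.ncard = sInf S := by
      obtain ⟨T', hTT', -, hcard⟩ := Set.exists_subsuperset_card_eq (Set.subset_univ T) hT
        (huniv ▸ Nat.sInf_le hSmem)
      exact ⟨T', hTT', hcard⟩
    obtain ⟨X', hXX', hX'⟩ := hpad X hX
    obtain ⟨Y', hYY', hY'⟩ := hpad Y hY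
    have hle : sInf Z ≤ 2 * (X'.ncard : ℤ) - Fintype.card V :=
      csInf_le hZbdd ⟨X', Y', hX'.trans hY'.symm,
        fun u v huv => (h u v huv).imp (@hXX' u) (@hYY' v), rfl⟩
    omega
end

section
/- Let G be a finite undirected simple bipartite graph with no isolated vertices. Then h(G,2) = M(G) = VC(G), where M(G) is the matching number of G and VC(G) is the minimum size of a vertex cover of G. -/
/-- `F` is a matching of the simple graph `G`: a set of edges of `G` that are
pairwise vertex-disjoint. -/
def IsMatchingSet {V : Type*} (G : SimpleGraph V) (F : Set (Sym2 V)) : Prop :=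
  F ⊆ G.edgeSet ∧ ∀ e ∈ F, ∀ f ∈ F, e ≠ f → ∀ v : V, ¬(v ∈ e ∧ v ∈ f)

/-- The matching number `M(G)`: the maximum size of a matching of `G`. -/
noncomputable def matchingNumber {V : Type*} (G : SimpleGraph V) : ℕ :=
  sSup {m : ℕ | ∃ F : Set (Sym2 V), IsMatchingSet G F ∧ F.ncard = m}

/-- `S` is a vertex cover of `G`. -/
def IsVertexCover {V : Type*} (G : SimpleGraph V) (S : Set V) : Prop :=
  ∀ u v, G.Adj u v → u ∈ S ∨ v ∈ S

/-- The vertex cover number `VC(G)`: the minimum size of a vertex cover of `G`. -/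
noncomputable def vcNumber {V : Type*} (G : SimpleGraph V) : ℕ :=
  sInf {m : ℕ | ∃ S : Set V, IsVertexCover G S ∧ S.ncard = m}

open scoped Classical in
theorem exists_injOn_adj_of_minimum_cover {V : Type*} [Fintype V] {G : SimpleGraph V}
    {S : Set V} (hS : IsVertexCover G S) (hmin : ∀ C, IsVertexCover G C → S.ncard ≤ C.ncard)
    {T : Set V} (hTS : T ⊆ S) (hT : G.IsIndepSet T) :
    ∃ f : V → V, (∀ x ∈ T, G.Adj x (f x) ∧ f x ∉ S) ∧ Set.InjOn f T := by
  have hall : ∀ X : Finset T,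
      X.card ≤ (X.biUnion fun x ↦ Finset.univ.filter fun v ↦ G.Adj x v ∧ v ∉ S).card := by
    intro X
    set Y : Set V := Subtype.val '' (X : Set T) with hY
    set N := X.biUnion fun x ↦ Finset.univ.filter fun v ↦ G.Adj x v ∧ v ∉ S with hN
    have hYT : Y ⊆ T := by rintro _ ⟨x, -, rfl⟩; exact x.2
    have hYc : Y.ncard = X.card := by
      rw [hY, Set.ncard_image_of_injective _ Subtype.val_injective, Set.ncard_coe_finset]
    have hNY : ∀ u v, u ∈ Y → G.Adj u v → v ∉ S → v ∈ N := by
      rintro _ v ⟨x, hx, rfl⟩ ha hv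
      simp only [hN, Finset.mem_biUnion, Finset.mem_filter, Finset.mem_univ, true_and]
      exact ⟨x, hx, ha, hv⟩
    have key : ∀ u v, G.Adj u v → u ∈ S → u ∈ S \ Y ∪ N ∨ v ∈ S \ Y ∪ N := by
      intro u v ha hu
      by_cases huY : u ∈ Y
      · right
        by_cases hv : v ∈ S
        · exact .inl ⟨hv, fun hvY ↦ hT (hYT huY) (hYT hvY) ha.ne ha⟩
        · exact .inr (hNY u v huY ha hv)
      · exact .inl (.inl ⟨hu, huY⟩)
    have hcov : IsVertexCover G (S \ Y ∪ N) := fun u v ha ↦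
      (hS u v ha).elim (key u v ha) fun hv ↦ (key v u ha.symm hv).symm
    have h₁ := hmin _ hcov
    have h₂ := Set.ncard_union_le (S \ Y) (N : Set V)
    have h₃ := Set.ncard_sdiff_add_ncard_of_subset (hYT.trans hTS)
    rw [Set.ncard_coe_finset] at h₂
    omega
  obtain ⟨f, hf, hft⟩ := (Finset.all_card_le_biUnion_card_iff_exists_injective _).1 hall
  refine ⟨fun x ↦ if h : x ∈ T then f ⟨x, h⟩ else x, fun x hx ↦ ?_, fun x hx y hy hxy ↦ ?_⟩
  · simpa [hx] using hft ⟨x, hx⟩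
  · simp only [hx, hy, dite_true] at hxy
    exact congrArg Subtype.val (hf hxy)

/-- Kőnig's theorem: a minimum vertex cover of a bipartite graph is matched by some matching. -/
theorem exists_matching_of_minimum_cover {V : Type*} [Fintype V] {G : SimpleGraph V}
    (c : G.Coloring (Fin 2)) {S : Set V} (hS : IsVertexCover G S)
    (hmin : ∀ C, IsVertexCover G C → S.ncard ≤ C.ncard) :
    ∃ F : Set (Sym2 V), IsMatchingSet G F ∧ F.ncard = S.ncard := by
  have hind (i : Fin 2) : G.IsIndepSet {x | x ∈ S ∧ c x = i} :=
    fun x hx y hy _ ha ↦ c.valid ha (hx.2.trans hy.2.symm)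
  choose f hf hinj using fun i ↦
    exists_injOn_adj_of_minimum_cover hS hmin (fun _ hx ↦ hx.1) (hind i)
  let g : V → V := fun x ↦ f (c x) x
  have hg (x) (hx : x ∈ S) : G.Adj x (g x) ∧ g x ∉ S := hf (c x) x ⟨hx, rfl⟩
  have hginj : Set.InjOn g S := by
    intro x hx y hy hxy
    have hcx := c.valid (hg x hx).1
    have hcy := c.valid (hg y hy).1
    rw [← hxy] at hcy
    have hc : c x = c y := by omega
    refine hinj (c x) ⟨hx, rfl⟩ ⟨hy, hc.symm⟩ ?_
    simpa only [g, ← hc] using hxy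
  refine ⟨(fun x ↦ s(x, g x)) '' S, ⟨?_, ?_⟩, Set.InjOn.ncard_image ?_⟩
  · rintro _ ⟨x, hx, rfl⟩
    exact (hg x hx).1
  · rintro _ ⟨x, hx, rfl⟩ _ ⟨y, hy, rfl⟩ hne v ⟨hvx, hvy⟩
    have hxy : x ≠ y := fun h ↦ hne (by rw [h])
    rcases Sym2.mem_iff.1 hvx with rfl | rfl <;> rcases Sym2.mem_iff.1 hvy with h | h
    · exact hxy h
    · exact (hg y hy).2 (h ▸ hx)
    · exact (hg x hx).2 (h ▸ hy)
    · exact hxy (hginj hx hy h)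
  · intro x hx y hy hxy
    rcases Sym2.eq_iff.1 hxy with h | h
    · exact h.1
    · exact absurd (h.1 ▸ hx) (hg y hy).2

theorem IsMatchingSet.ncard_le_of_isVertexCover {V : Type*} [Finite V] {G : SimpleGraph V}
    {F : Set (Sym2 V)} {S : Set V} (hF : IsMatchingSet G F) (hS : IsVertexCover G S) :
    F.ncard ≤ S.ncard := by
  have hex (e : Sym2 V) : ∃ v, e ∈ F → v ∈ e ∧ v ∈ S := by
    induction e with | _ u v
    by_cases he : s(u, v) ∈ F
    · rcases hS u v (hF.1 he) with h | h
      · exact ⟨u, fun _ ↦ ⟨Sym2.mem_mk_left u v, h⟩⟩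
      · exact ⟨v, fun _ ↦ ⟨Sym2.mem_mk_right u v, h⟩⟩
    · exact ⟨u, fun h ↦ absurd h he⟩
  choose p hp using hex
  refine Set.ncard_le_ncard_of_injOn p (fun e he ↦ (hp e he).2) fun e he e' he' h ↦ ?_
  by_contra hne
  exact hF.2 e he e' he' hne (p e) ⟨(hp e he).1, h ▸ (hp e' he').1⟩

theorem terr_univ_one_eq_empty_iff {V : Type*} {adj : V → V → Prop} {W : ℕ → Set V} :
    terr adj Set.univ W 1 = ∅ ↔ ∀ u v, adj u v → u ∈ W 0 ∨ v ∈ W 1 := by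
  simp only [terr, nbhd, Set.eq_empty_iff_forall_notMem, Set.mem_sdiff, Set.mem_ofPred_eq,
    Set.mem_univ, true_and, not_and, not_not]
  grind

/-- Splitting the two shots along the colour classes yields two vertex covers whose sizes add up
to the total number of shots. -/
theorem exists_cover_ncard_le_of_terr_eq_empty {V : Type*} [Finite V] {G : SimpleGraph V}
    (c : G.Coloring (Fin 2)) {W : ℕ → Set V} {k : ℕ} (hk : UsesAtMost W k)
    (hW : terr G.Adj Set.univ W 1 = ∅) : ∃ S, IsVertexCover G S ∧ S.ncard ≤ k := by
  rw [terr_univ_one_eq_empty_iff] at hW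
  set A : Set V := {v | c v = 0}
  have hA (u v) (h : G.Adj u v) : u ∈ A ↔ v ∉ A := by
    have := c.valid h
    change c u = 0 ↔ ¬ c v = 0
    omega
  have h₁ : IsVertexCover G (W 0 ∩ A ∪ W 1 \ A) := by
    intro u v h
    have := hA u v h
    have := hW u v h
    have := hW v u h.symm
    simp only [Set.mem_union, Set.mem_inter_iff, Set.mem_sdiff]
    tauto
  have h₂ : IsVertexCover G (W 1 ∩ A ∪ W 0 \ A) := by
    intro u v h
    have := hA u v h
    have := hW u v h
    have := hW v u h.symm
    simp only [Set.mem_union, Set.mem_inter_iff, Set.mem_sdiff]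
    tauto
  have := Set.ncard_union_le (W 0 ∩ A) (W 1 \ A)
  have := Set.ncard_union_le (W 1 ∩ A) (W 0 \ A)
  have := Set.ncard_inter_add_ncard_sdiff_eq_ncard (W 0) A
  have := Set.ncard_inter_add_ncard_sdiff_eq_ncard (W 1) A
  have := hk 0
  have := hk 1
  by_cases h : (W 0 ∩ A ∪ W 1 \ A).ncard ≤ k
  · exact ⟨_, h₁, h⟩
  · exact ⟨_, h₂, by omega⟩

/-- for a bipartite simple graph `G` with no isolated vertices,
`h(G,2) = M(G) = VC(G)`. -/
theorem bipartite_h2_eq_matching_eq_vc {V : Type*} [Fintype V]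
    (G : SimpleGraph V) (hbip : G.Colorable 2) (hniso : ∀ v, ∃ u, G.Adj v u) :
    huntingNumberTL G.Adj 2 = matchingNumber G ∧ matchingNumber G = vcNumber G := by
  obtain ⟨c⟩ := hbip
  obtain ⟨S, hS, hSc⟩ : ∃ S, IsVertexCover G S ∧ S.ncard = vcNumber G :=
    Nat.sInf_mem (s := {m | ∃ S, IsVertexCover G S ∧ S.ncard = m})
      ⟨_, Set.univ, fun _ _ _ ↦ .inl trivial, rfl⟩
  have hmin (C) (hC : IsVertexCover G C) : S.ncard ≤ C.ncard :=
    hSc.trans_le (Nat.sInf_le ⟨C, hC, rfl⟩)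
  have hM : matchingNumber G = S.ncard := by
    refine IsGreatest.csSup_eq ⟨exists_matching_of_minimum_cover c hS hmin, ?_⟩
    rintro _ ⟨F, hF, rfl⟩
    exact hF.ncard_le_of_isVertexCover hS
  have hH : huntingNumberTL G.Adj 2 = S.ncard := by
    refine IsLeast.csInf_eq ⟨⟨fun _ ↦ S, fun _ ↦ le_rfl, terr_univ_one_eq_empty_iff.2 hS⟩, ?_⟩
    rintro k ⟨W, hk, hW⟩
    obtain ⟨C, hC, hCk⟩ := exists_cover_ncard_le_of_terr_eq_empty c hk hW
    exact (hmin C hC).trans hCk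
  exact ⟨hH.trans hM.symm, hM.trans hSc⟩
end

section
/- Let G = (V,E) be a finite undirected graph with no isolated vertices. If W_1, W_2, ..., W_l is a winning hunter strategy of length l on G (i.e., the rabbit territory after l rounds is empty), then the reversed sequence W_l, W_{l-1}, ..., W_1 is also a winning hunter strategy of length l on G. -/
/-- A vertex lies in the rabbit territory at time `t` iff it is the endpoint of a walk that
starts in `S` and avoids the hunters at all times up to `t`. -/
theorem mem_terr_iff {V : Type*} {adj : V → V → Prop} {S : Set V} {W : ℕ → Set V}
    {t : ℕ} {v : V} :
    v ∈ terr adj S W t ↔ ∃ p : ℕ → V, p 0 ∈ S ∧ p t = v ∧ (∀ i ≤ t, p i ∉ W i) ∧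
      ∀ i < t, adj (p i) (p (i + 1)) := by
  induction t generalizing v with
  | zero =>
    constructor
    · rintro ⟨hS, hW⟩
      exact ⟨fun _ => v, hS, rfl, fun i hi => by rwa [Nat.le_zero.1 hi], by simp⟩
    · rintro ⟨p, hS, rfl, hW, -⟩
      exact ⟨hS, hW 0 le_rfl⟩
  | succ t ih =>
    constructor
    · rintro ⟨⟨u, hu, huv⟩, hv⟩
      obtain ⟨p, hS, rfl, hW, hadj⟩ := ih.1 hu
      refine ⟨fun i => if i ≤ t then p i else v, by simpa using hS, by simp, ?_, ?_⟩
      · intro i hi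
        rcases Nat.le_succ_iff.1 hi with h | rfl
        · simpa [h] using hW i h
        · simpa using hv
      · intro i hi
        rcases Nat.lt_succ_iff_lt_or_eq.1 hi with h | rfl
        · simpa [h.le, Nat.succ_le_of_lt h] using hadj i h
        · simpa using huv
    · rintro ⟨p, hS, rfl, hW, hadj⟩
      exact ⟨⟨p t, ih.2 ⟨p, hS, rfl, fun i hi => hW i (by omega), fun i hi => hadj i (by omega)⟩,
        hadj t (by omega)⟩, hW _ le_rfl⟩

/-- if `W_1, …, W_l` is a winning hunter strategy of length `l`
(the territory after `l` rounds is empty), then the reversed strategy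
`W_l, W_{l-1}, …, W_1` is also winning. -/
theorem reversed_strategy_winning {V : Type*} [Fintype V]
    (adj : V → V → Prop) (hsymm : Symmetric adj) (hniso : ∀ v, ∃ u, adj v u)
    (l : ℕ) (hl : 1 ≤ l) (W : ℕ → Set V)
    (hwin : terr adj Set.univ W (l - 1) = ∅) :
    terr adj Set.univ (fun t => W (l - 1 - t)) (l - 1) = ∅ := by
  refine Set.eq_empty_of_forall_notMem fun v hv => ?_
  obtain ⟨p, -, -, hW, hadj⟩ := mem_terr_iff.1 hv
  refine Set.notMem_empty (p 0) (hwin ▸ mem_terr_iff.2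
    ⟨fun i => p (l - 1 - i), trivial, by simp, fun i hi => ?_, fun i hi => hsymm ?_⟩)
  · simpa [Nat.sub_sub_self hi] using hW (l - 1 - i) (Nat.sub_le _ _)
  · have h := hadj (l - 1 - (i + 1)) (by omega)
    rwa [show l - 1 - (i + 1) + 1 = l - 1 - i by omega] at h
end

section
/- Let G be a finite undirected graph, possibly with loops, with no isolated vertices. Then h(G) = 1 if and only if G contains none of the following as a subgraph: a cycle; two looped vertices joined by a path (i.e., two distinct vertices each carrying a loop that are connected by a path); the 3-spider H_1 (a tree consisting of a center vertex x and three internally disjoint paths of length 3 attached to x); the graph H_2 (two paths c_1 b_1 a_1 x a_2 b_2 c_2 and x a_3 b_3 sharing only the vertex x, with a loop at b_3); the graph H_3 (two paths c_1 b_1 a_1 x a_2 b_2 c_2 and x a_3 sharing only the vertex x, with a loop at a_3); the graph H_4 (a path c_1 b_1 a_1 x a_2 b_2 c_2 with a loop at the middle vertex x). -/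
/-- `G` contains a cycle as a subgraph: distinct vertices `v_0, …, v_{m-1}` (`m ≥ 3`)
with `v_i v_{i+1 mod m}` an edge for every `i` (a loop does not count as a cycle). -/
def HasCycle {V : Type*} (adj : V → V → Prop) : Prop :=
  ∃ (m : ℕ) (v : Fin (m + 3) → V), Function.Injective v ∧
    ∀ i : Fin (m + 3), adj (v i) (v (i + 1))

/-- `G` contains two looped vertices joined by a path: distinct vertices
`v_0, …, v_{m+1}` (so at least two of them) forming a path, with loops at the
two endpoints `v_0` and `v_{m+1}`. -/
def HasTwoLoopsJoinedByPath {V : Type*} (adj : V → V → Prop) : Prop :=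
  ∃ (m : ℕ) (v : Fin (m + 2) → V), Function.Injective v ∧
    (∀ i : Fin (m + 1), adj (v i.castSucc) (v i.succ)) ∧
    adj (v 0) (v 0) ∧ adj (v (Fin.last (m + 1))) (v (Fin.last (m + 1)))

/-- `G` contains the 3-spider `H_1`: a center `x` with three internally disjoint
paths `x a_i b_i c_i` of length 3 (all ten vertices distinct). -/
def HasH1 {V : Type*} (adj : V → V → Prop) : Prop :=
  ∃ x a1 b1 c1 a2 b2 c2 a3 b3 c3 : V,
    ([x, a1, b1, c1, a2, b2, c2, a3, b3, c3] : List V).Nodup ∧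
    adj x a1 ∧ adj a1 b1 ∧ adj b1 c1 ∧
    adj x a2 ∧ adj a2 b2 ∧ adj b2 c2 ∧
    adj x a3 ∧ adj a3 b3 ∧ adj b3 c3

/-- `G` contains `H_2`: paths `c_1 b_1 a_1 x a_2 b_2 c_2` and `x a_3 b_3` sharing
only the vertex `x` (all nine vertices distinct), with a loop at `b_3`. -/
def HasH2 {V : Type*} (adj : V → V → Prop) : Prop :=
  ∃ x a1 b1 c1 a2 b2 c2 a3 b3 : V,
    ([x, a1, b1, c1, a2, b2, c2, a3, b3] : List V).Nodup ∧
    adj x a1 ∧ adj a1 b1 ∧ adj b1 c1 ∧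
    adj x a2 ∧ adj a2 b2 ∧ adj b2 c2 ∧
    adj x a3 ∧ adj a3 b3 ∧ adj b3 b3

/-- `G` contains `H_3`: paths `c_1 b_1 a_1 x a_2 b_2 c_2` and `x a_3` sharing
only the vertex `x` (all eight vertices distinct), with a loop at `a_3`. -/
def HasH3 {V : Type*} (adj : V → V → Prop) : Prop :=
  ∃ x a1 b1 c1 a2 b2 c2 a3 : V,
    ([x, a1, b1, c1, a2, b2, c2, a3] : List V).Nodup ∧
    adj x a1 ∧ adj a1 b1 ∧ adj b1 c1 ∧
    adj x a2 ∧ adj a2 b2 ∧ adj b2 c2 ∧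
    adj x a3 ∧ adj a3 a3

/-- `G` contains `H_4`: a path `c_1 b_1 a_1 x a_2 b_2 c_2` (all seven vertices
distinct) with a loop at the middle vertex `x`. -/
def HasH4 {V : Type*} (adj : V → V → Prop) : Prop :=
  ∃ x a1 b1 c1 a2 b2 c2 : V,
    ([x, a1, b1, c1, a2, b2, c2] : List V).Nodup ∧
    adj x a1 ∧ adj a1 b1 ∧ adj b1 c1 ∧
    adj x a2 ∧ adj a2 b2 ∧ adj b2 c2 ∧
    adj x x

namespace HuntersRabbit

variable {V : Type*} {adj : V → V → Prop}

theorem nbhd_mono {A B : Set V} (h : A ⊆ B) : nbhd adj A ⊆ nbhd adj B :=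
  fun _ ⟨u, hu, huv⟩ => ⟨u, h hu, huv⟩

/-- Territories from which one hunter can catch the rabbit, by shooting one vertex at a time. -/
inductive Huntable (adj : V → V → Prop) : Set V → Prop
  | empty : Huntable adj ∅
  | shoot (X : Set V) (w : V) : Huntable adj (nbhd adj (X \ {w})) → Huntable adj X

theorem Huntable.mono {X : Set V} (h : Huntable adj X) : ∀ {Y : Set V}, Y ⊆ X → Huntable adj Y := by
  induction h with
  | empty =>
    intro Y hY
    rw [Set.subset_empty_iff.1 hY]
    exact .empty
  | shoot X w _ ih => exact fun hY => .shoot _ w (ih (nbhd_mono (Set.sdiff_subset_sdiff_left hY)))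

theorem terr_succ_eq (X : Set V) (W : ℕ → Set V) (t : ℕ) :
    terr adj X W (t + 1) = terr adj (nbhd adj (X \ W 0)) (fun s => W (s + 1)) t := by
  induction t with
  | zero => rfl
  | succ t ih =>
    change nbhd adj (terr adj X W (t + 1)) \ W (t + 2) = _
    rw [ih]
    rfl

theorem Huntable.exists_strategy {X : Set V} (h : Huntable adj X) :
    ∃ W : ℕ → Set V, UsesAtMost W 1 ∧ ∃ T, terr adj X W T = ∅ := by
  induction h with
  | empty => exact ⟨fun _ => ∅, fun t => by simp, 0, by simp [terr]⟩
  | shoot X w _ ih =>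
    obtain ⟨W, hW, T, hT⟩ := ih
    refine ⟨fun t => Nat.casesOn t {w} W, fun t => ?_, T + 1, ?_⟩
    · cases t with
      | zero => simp
      | succ t => exact hW t
    · rw [terr_succ_eq]
      exact hT

/-- `Branch adj v u b y`: some non-backtracking walk starting with the step `v → u` ends at `y`,
with `b` telling whether its length is odd. -/
inductive Branch (adj : V → V → Prop) : V → V → Bool → V → Prop
  | head {v u : V} : adj v u → Branch adj v u true u
  | cons {v u w y : V} {b : Bool} : adj v u → adj u w → w ≠ v → Branch adj u w b y →
      Branch adj v u (!b) y

theorem Branch.adj_head {v u y : V} {b : Bool} (h : Branch adj v u b y) : adj v u := by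
  cases h <;> assumption

theorem Branch.step {v u y y' : V} {b : Bool} (h : Branch adj v u b y) (hy : adj y y') :
    Branch adj v u (!b) y' ∨ b = true ∧ y' = v := by
  induction h with
  | @head v u hvu =>
    by_cases hv : y' = v
    · exact .inr ⟨rfl, hv⟩
    · exact .inl (.cons hvu hy hv (.head hy))
  | @cons v u w y b hvu huw hwv _ ih =>
    rcases ih hy with h | ⟨rfl, rfl⟩
    · exact .inl (.cons hvu huw hwv h)
    · exact .inl (.head hvu)

/-- The vertices at even distance from `v` in the branches at `v` towards the vertices of `S`. -/
def evenBranches (adj : V → V → Prop) (v : V) (S : Set V) : Set V :=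
  {y | ∃ u ∈ S, Branch adj v u false y}

/-- The step `v → u` extends to a non-backtracking walk of length three. -/
def LongStep (adj : V → V → Prop) (v u : V) : Prop :=
  ∃ w z, adj u w ∧ w ≠ v ∧ adj w z ∧ z ≠ u

theorem Branch.adj_of_not_longStep {v u y y' : V} (hu : ¬ LongStep adj v u)
    (h : Branch adj v u false y) (hy : adj y y') : y' = u := by
  generalize hb : false = b at h
  cases h with
  | head => cases hb
  | @cons _ _ w _ b hvu huw hwv h =>
    by_contra hne
    cases h with
    | head => exact hu ⟨y, y', huw, hwv, hy, hne⟩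
    | @cons _ _ z _ b _ hwz hzu h => exact hu ⟨w, z, huw, hwv, hwz, hzu⟩

theorem nbhd_evenBranches_subset (v : V) (S : Set V) :
    nbhd adj (evenBranches adj v S) ⊆ {y | ∃ u ∈ S, Branch adj v u true y} := by
  rintro y ⟨z, ⟨u, hu, hz⟩, hzy⟩
  rcases hz.step hzy with h | ⟨h, _⟩
  · exact ⟨u, hu, h⟩
  · cases h

/-- With the hunter at `v`, a short branch is cleared by shooting its root and then `v` again. -/
theorem huntable_insert_short {v w : V} {S : Set V} (hw : ¬ LongStep adj v w)
    (h : Huntable adj (nbhd adj (evenBranches adj v S))) :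
    Huntable adj (nbhd adj (evenBranches adj v (insert w S))) := by
  refine .shoot _ w (.shoot _ v (h.mono (nbhd_mono ?_)))
  rintro y ⟨⟨z, ⟨⟨p, ⟨u, hu, hp⟩, hpz⟩, hzw⟩, hzy⟩, hyv⟩
  rcases hu with rfl | hu
  · exact absurd (hp.adj_of_not_longStep hw hpz) hzw
  · obtain ⟨u, hu, hz⟩ := nbhd_evenBranches_subset v S ⟨p, ⟨u, hu, hp⟩, hpz⟩
    rcases hz.step hzy with h | ⟨_, h⟩
    · exact ⟨u, hu, h⟩
    · exact absurd h hyv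

theorem huntable_of_short_diff [Finite V] {v : V} {S S' : Set V}
    (hS : ∀ w ∈ S, w ∉ S' → ¬ LongStep adj v w)
    (h : Huntable adj (nbhd adj (evenBranches adj v S'))) :
    Huntable adj (nbhd adj (evenBranches adj v S)) := by
  have key : ∀ F : Set V, F.Finite → (∀ w ∈ F, ¬ LongStep adj v w) →
      Huntable adj (nbhd adj (evenBranches adj v (F ∪ S'))) := by
    intro F hF
    induction F, hF using Set.Finite.induction_on with
    | empty => intro _; simpa using h
    | @insert w F _ _ ih =>
      intro hw
      rw [Set.insert_union]
      exact huntable_insert_short (hw w (by simp)) (ih fun u hu => hw u (by simp [hu]))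
  refine (key (S \ S') (Set.toFinite _) fun w hw => hS w hw.1 hw.2).mono (nbhd_mono ?_)
  rintro y ⟨u, hu, hy⟩
  exact ⟨u, by by_cases h : u ∈ S' <;> simp [h, hu], hy⟩

theorem huntable_evenBranches_of_forall_short [Finite V] {v : V} {S : Set V}
    (hS : ∀ w ∈ S, ¬ LongStep adj v w) : Huntable adj (nbhd adj (evenBranches adj v S)) := by
  refine huntable_of_short_diff (S' := ∅) (fun w hw _ => hS w hw) (Huntable.empty.mono ?_)
  rintro y ⟨z, ⟨u, hu, _⟩, _⟩
  exact hu

/-- `e` continues `d` without backtracking. -/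
def DartNext (adj : V → V → Prop) (e d : V × V) : Prop :=
  adj d.1 d.2 ∧ adj e.1 e.2 ∧ e.1 = d.2 ∧ e.2 ≠ d.1

/-- No vertex starts three different non-backtracking walks of length three. -/
def SpiderFree (adj : V → V → Prop) : Prop :=
  ∀ x a₁ a₂ a₃, adj x a₁ → adj x a₂ → adj x a₃ → LongStep adj x a₁ → LongStep adj x a₂ →
    LongStep adj x a₃ → a₁ ≠ a₂ → a₁ ≠ a₃ → a₂ ≠ a₃ → False

theorem huntable_evenBranches_singleton [Finite V] (hsymm : ∀ ⦃u v⦄, adj u v → adj v u)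
    (hwf : WellFounded (DartNext adj)) (hsp : SpiderFree adj) (d : V × V) :
    adj d.1 d.2 → LongStep adj d.2 d.1 →
      Huntable adj (nbhd adj (evenBranches adj d.1 {d.2})) := by
  induction d using hwf.induction with
  | _ d ih =>
  obtain ⟨v, u⟩ := d
  intro hvu hlong
  simp only at hvu hlong ih ⊢
  have key : Huntable adj (nbhd adj (evenBranches adj u {w | adj u w ∧ w ≠ v})) := by
    by_cases hex : ∃ w, adj u w ∧ w ≠ v ∧ LongStep adj u w
    · obtain ⟨w, huw, hwv, hw⟩ := hex
      refine huntable_of_short_diff (S' := {w}) ?_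
        (ih (u, w) ⟨hvu, huw, rfl, hwv⟩ huw ?_)
      · rintro w' ⟨huw', hwv'⟩ hne hw'
        exact hsp u v w w' (hsymm hvu) huw huw' hlong hw hw' hwv.symm hwv'.symm
          fun h => hne h.symm
      · obtain ⟨z, _, hvz, hzu, _⟩ := hlong
        exact ⟨v, z, hsymm hvu, hwv.symm, hvz, hzu⟩
    · push Not at hex
      exact huntable_evenBranches_of_forall_short fun w hw => hex w hw.1 hw.2
  refine .shoot _ u (key.mono (nbhd_mono ?_))
  rintro y ⟨hy, hyu⟩
  obtain ⟨_, rfl, hbr⟩ := nbhd_evenBranches_subset v {u} hy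
  generalize hb : true = b at hbr
  cases hbr with
  | head => exact absurd rfl hyu
  | @cons _ _ w _ b _ huw hwv h =>
    cases b
    · exact ⟨w, ⟨huw, hwv⟩, h⟩
    · cases hb

/-- `WalkTo adj v b y`: some walk from `v` ends at `y`, with `b` telling whether its length is
odd. -/
inductive WalkTo (adj : V → V → Prop) (v : V) : Bool → V → Prop
  | nil : WalkTo adj v false v
  | snoc {b : Bool} {y z : V} : WalkTo adj v b y → adj y z → WalkTo adj v (!b) z

theorem WalkTo.branch {v y : V} {b : Bool} (h : WalkTo adj v b y) :
    b = false ∧ y = v ∨ ∃ u, Branch adj v u b y := by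
  induction h with
  | nil => exact .inl ⟨rfl, rfl⟩
  | @snoc b y z _ hyz ih =>
    rcases ih with ⟨rfl, rfl⟩ | ⟨u, hu⟩
    · exact .inr ⟨z, .head hyz⟩
    · rcases hu.step hyz with h | ⟨rfl, rfl⟩
      · exact .inr ⟨u, h⟩
      · exact .inl ⟨rfl, rfl⟩

theorem WalkTo.change_start {v u y : V} {b : Bool}
    (hsymm : ∀ ⦃u v⦄, adj u v → adj v u) (hvu : adj v u) (h : WalkTo adj v b y) :
    WalkTo adj u (!b) y := by
  induction h with
  | nil => exact .snoc .nil (hsymm hvu)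
  | snoc _ hyz ih => exact .snoc ih hyz

theorem nbhd_walkTo_subset (v : V) (b : Bool) :
    nbhd adj {y | WalkTo adj v b y} ⊆ {y | WalkTo adj v (!b) y} :=
  fun _ ⟨_, hy, hyz⟩ => .snoc hy hyz

theorem huntable_walkTo_of_false {v : V} (h : Huntable adj {y | WalkTo adj v false y}) (b : Bool) :
    Huntable adj {y | WalkTo adj v b y} := by
  cases b
  · exact h
  · exact .shoot _ v (h.mono ((nbhd_mono Set.sdiff_subset).trans (nbhd_walkTo_subset v true)))

theorem huntable_walkTo_of_evenBranches {v : V}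
    (h : Huntable adj (nbhd adj (evenBranches adj v Set.univ))) (b : Bool) :
    Huntable adj {y | WalkTo adj v b y} := by
  refine huntable_walkTo_of_false (.shoot _ v (h.mono (nbhd_mono ?_))) b
  rintro y ⟨hy, hyv⟩
  rcases hy.branch with ⟨_, h⟩ | ⟨u, hu⟩
  · exact absurd h hyv
  · exact ⟨u, trivial, hu⟩

theorem huntable_walkTo_of_longStep [Finite V] (hsymm : ∀ ⦃u v⦄, adj u v → adj v u)
    (hwf : WellFounded (DartNext adj)) (hsp : SpiderFree adj) (d : V × V) :
    adj d.1 d.2 → LongStep adj d.1 d.2 → ∀ b, Huntable adj {y | WalkTo adj d.2 b y} := by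
  induction d using hwf.induction with
  | _ d ih =>
  obtain ⟨u, v⟩ := d
  intro huv hlong b
  simp only at huv hlong ih ⊢
  by_cases hex : ∃ w, adj v w ∧ w ≠ u ∧ LongStep adj v w
  · obtain ⟨w, hvw, hwu, hw⟩ := hex
    exact (ih (v, w) ⟨huv, hvw, rfl, hwu⟩ hvw hw (!b)).mono
      fun y hy => WalkTo.change_start hsymm hvw hy
  · push Not at hex
    refine huntable_walkTo_of_evenBranches ?_ b
    have h1 : Huntable adj (nbhd adj (evenBranches adj v {w | adj v w})) :=
      huntable_of_short_diff (fun w hw hwu => hex w hw hwu)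
        (huntable_evenBranches_singleton hsymm hwf hsp (v, u) (hsymm huv) hlong)
    refine h1.mono (nbhd_mono ?_)
    rintro y ⟨w, _, hw⟩
    exact ⟨w, hw.adj_head, hw⟩

theorem huntable_walkTo [Finite V] (hsymm : ∀ ⦃u v⦄, adj u v → adj v u)
    (hwf : WellFounded (DartNext adj)) (hsp : SpiderFree adj) (v : V) (b : Bool) :
    Huntable adj {y | WalkTo adj v b y} := by
  by_cases hex : ∃ u, adj v u ∧ LongStep adj v u
  · obtain ⟨u, hvu, hu⟩ := hex
    exact (huntable_walkTo_of_longStep hsymm hwf hsp (v, u) hvu hu (!b)).mono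
      fun y hy => WalkTo.change_start hsymm hvu hy
  · push Not at hex
    refine huntable_walkTo_of_evenBranches
      ((huntable_evenBranches_of_forall_short (S := {w | adj v w}) hex).mono (nbhd_mono ?_)) b
    rintro y ⟨w, _, hw⟩
    exact ⟨w, hw.adj_head, hw⟩

theorem Huntable.union {X : Set V} (hX : Huntable adj X) {Y : Bool → Set V}
    (hnbhd : ∀ b, nbhd adj (Y b) ⊆ Y (!b)) (hY : ∀ b, Huntable adj (Y b)) :
    ∀ b, Huntable adj (X ∪ Y b) := by
  induction hX with
  | empty => simpa using hY
  | shoot X w _ ih =>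
    refine fun b => .shoot _ w ((ih (!b)).mono ?_)
    rintro z ⟨y, ⟨hy | hy, hyw⟩, hyz⟩
    · exact .inl ⟨y, ⟨hy, hyw⟩, hyz⟩
    · exact .inr (hnbhd b ⟨y, hy, hyz⟩)

theorem huntable_univ [Finite V] (hsymm : ∀ ⦃u v⦄, adj u v → adj v u)
    (hwf : WellFounded (DartNext adj)) (hsp : SpiderFree adj) : Huntable adj Set.univ := by
  have key : ∀ F : Set V, F.Finite → ∀ b, Huntable adj {y | ∃ v ∈ F, WalkTo adj v b y} := by
    intro F hF
    induction F, hF using Set.Finite.induction_on with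
    | empty => exact fun _ => Huntable.empty.mono fun y ⟨_, hv, _⟩ => hv
    | @insert w F _ _ ih =>
      intro b
      refine ((huntable_walkTo hsymm hwf hsp w b).union (fun b => ?_) ih b).mono ?_
      · rintro z ⟨y, ⟨v, hv, hy⟩, hyz⟩
        exact ⟨v, hv, .snoc hy hyz⟩
      · rintro y ⟨v, rfl | hv, hy⟩
        · exact .inl hy
        · exact .inr ⟨v, hv, hy⟩
  exact (key Set.univ Set.finite_univ false).mono fun y _ => ⟨y, trivial, .nil⟩

/-- Every vertex of `S` has at least two neighbors in `S`, a loop counting once. -/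
def MinDegreeTwo (adj : V → V → Prop) (S : Set V) : Prop :=
  ∀ v ∈ S, ∃ y ∈ S, ∃ z ∈ S, y ≠ z ∧ adj v y ∧ adj v z

/-- `f 0, …, f m` is a path inside `S`. -/
structure IsPathIn (adj : V → V → Prop) (S : Set V) (m : ℕ) (f : ℕ → V) : Prop where
  inj : ∀ i ≤ m, ∀ j ≤ m, f i = f j → i = j
  adj : ∀ i < m, adj (f i) (f (i + 1))
  mem : ∀ i ≤ m, f i ∈ S

theorem IsPathIn.reverse {S : Set V} {m : ℕ} {f : ℕ → V} (hsymm : ∀ ⦃u v⦄, adj u v → adj v u)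
    (h : IsPathIn adj S m f) : IsPathIn adj S m (fun i => f (m - i)) where
  inj i hi j hj hij := by
    have := h.inj (m - i) (by omega) (m - j) (by omega) hij
    omega
  adj i hi := by
    have := hsymm (h.adj (m - (i + 1)) (by omega))
    rwa [show m - (i + 1) + 1 = m - i by omega] at this
  mem i hi := h.mem _ (by omega)

theorem IsPathIn.hasCycle {S : Set V} {m j : ℕ} {f : ℕ → V}
    (h : IsPathIn adj S m f) (hj : j + 2 ≤ m) (hadj : adj (f m) (f j)) : HasCycle adj := by
  obtain ⟨k, rfl⟩ := Nat.exists_eq_add_of_le hj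
  refine ⟨k, fun i => f (j + i), fun i i' hii => ?_, fun i => ?_⟩
  · have := h.inj _ (by omega) _ (by omega) hii
    exact Fin.ext (by omega)
  · by_cases hi : i = Fin.last (k + 2)
    · subst hi
      simpa [show j + (k + 2) = j + 2 + k by omega] using hadj
    · have hlt := Fin.val_lt_last hi
      have hval : ((i + 1 : Fin (k + 3)) : ℕ) = i + 1 :=
        Fin.val_add_one_of_lt (Fin.lt_last_iff_ne_last.2 hi)
      simp only [hval]
      exact h.adj (j + i) (by omega)

theorem IsPathIn.extend {S : Set V} {m : ℕ} {f : ℕ → V} (h : IsPathIn adj S m f) {y : V}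
    (hy : y ∈ S) (hadj : adj (f m) y) (hne : ∀ i ≤ m, f i ≠ y) :
    IsPathIn adj S (m + 1) (fun i => if i ≤ m then f i else y) where
  inj i hi j hj hij := by
    have := h.inj i
    grind
  adj i hi := by
    have := h.adj i
    grind
  mem i hi := by
    have := h.mem i
    grind

theorem IsPathIn.loop_at_end {S : Set V} {m : ℕ} {f : ℕ → V} (h : IsPathIn adj S m f)
    (hS : MinDegreeTwo adj S) (hcyc : ¬ HasCycle adj)
    (hmax : ¬ ∃ g, IsPathIn adj S (m + 1) g) : adj (f m) (f m) ∧ 1 ≤ m := by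
  have key : ∀ y ∈ S, adj (f m) y → y = f m ∨ 1 ≤ m ∧ y = f (m - 1) := by
    intro y hy hadj
    by_cases hex : ∃ i ≤ m, f i = y
    · obtain ⟨i, hi, rfl⟩ := hex
      have : ¬ i + 2 ≤ m := fun hi => hcyc (h.hasCycle hi hadj)
      obtain rfl | hi' : i = m ∨ i = m - 1 ∧ 1 ≤ m := by omega
      · exact .inl rfl
      · exact .inr ⟨hi'.2, by rw [hi'.1]⟩
    · push Not at hex
      exact absurd ⟨_, h.extend hy hadj hex⟩ hmax
  obtain ⟨y, hy, z, hz, hyz, hay, haz⟩ := hS (f m) (h.mem m le_rfl)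
  have h1 := key y hy hay
  have h2 := key z hz haz
  grind

theorem hasCycle_or_hasTwoLoops [Fintype V] (hsymm : ∀ ⦃u v⦄, adj u v → adj v u) {S : Set V}
    (hne : S.Nonempty) (hS : MinDegreeTwo adj S) :
    HasCycle adj ∨ HasTwoLoopsJoinedByPath adj := by
  by_cases hcyc : HasCycle adj
  · exact .inl hcyc
  right
  have hbound : ∃ m, ¬ ∃ f, IsPathIn adj S m f := by
    refine ⟨Fintype.card V, fun ⟨f, hf⟩ => ?_⟩
    have := Fintype.card_le_of_injective (fun i : Fin (Fintype.card V + 1) => f i)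
      fun i j hij => Fin.ext (hf.inj _ (by omega) _ (by omega) hij)
    simp at this
  obtain ⟨m, ⟨f, hf⟩, hmax⟩ : ∃ m, (∃ f, IsPathIn adj S m f) ∧
      ¬ ∃ f, IsPathIn adj S (m + 1) f := by
    by_contra hcon
    push Not at hcon
    obtain ⟨n, hn⟩ := hbound
    refine hn ?_
    induction n with
    | zero =>
      obtain ⟨x, hx⟩ := hne
      exact ⟨fun _ => x, by intros; omega, by intros; omega, fun _ _ => hx⟩
    | succ n ih =>
      by_contra h
      exact h (hcon n (by by_contra h'; exact h' (ih h')))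
  obtain ⟨h1, hm⟩ := hf.loop_at_end hS hcyc hmax
  obtain ⟨h0, _⟩ := (hf.reverse hsymm).loop_at_end hS hcyc hmax
  obtain ⟨k, rfl⟩ := Nat.exists_eq_add_of_le' hm
  refine ⟨k, fun i => f i, fun i j hij => Fin.ext (hf.inj _ (by omega) _ (by omega) hij),
    fun i => hf.adj i i.2, by simpa using h0, by simpa using h1⟩

theorem wellFounded_dartNext [Finite V]
    (hS : ∀ S : Set V, S.Nonempty → ¬ MinDegreeTwo adj S) (hsymm : ∀ ⦃u v⦄, adj u v → adj v u) :
    WellFounded (DartNext adj) := by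
  refine Subrelation.wf (r := Relation.TransGen (DartNext adj)) (fun h => .single h) ?_
  have : Std.Irrefl (Relation.TransGen (DartNext adj)) := by
    refine ⟨fun d hd => hS {u | ∃ v, Relation.TransGen (DartNext adj) (v, u) (v, u)}
      ⟨d.2, d.1, hd⟩ ?_⟩
    rintro u ⟨v, hvu⟩
    obtain ⟨⟨p, q⟩, hpq, hp⟩ := Relation.TransGen.head'_iff.1 hvu
    obtain ⟨⟨u', w⟩, hw, huw⟩ := Relation.TransGen.tail'_iff.1 hvu
    obtain ⟨-, hadj, rfl, -⟩ := id hpq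
    obtain ⟨-, hadj', rfl, hne⟩ := id huw
    exact ⟨v, ⟨p, Relation.TransGen.tail'_iff.2 ⟨_, hp, hpq⟩⟩,
      w, ⟨u', Relation.TransGen.head'_iff.2 ⟨_, huw, hw⟩⟩, hne.symm, hsymm hadj, hadj'⟩
  exact Finite.wellFounded_of_trans_of_irrefl _

theorem not_closed_walk_three (hS : ∀ S : Set V, S.Nonempty → ¬ MinDegreeTwo adj S)
    (hsymm : ∀ ⦃u v⦄, adj u v → adj v u) {x a b : V} (h1 : adj x a) (h2 : adj a b) (h3 : adj b x)
    (n1 : x ≠ a) (n2 : a ≠ b) (n3 : b ≠ x) : False := by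
  refine hS {x, a, b} ⟨x, by simp⟩ ?_
  rintro v (rfl | rfl | rfl)
  · exact ⟨a, by simp, b, by simp, n2, h1, hsymm h3⟩
  · exact ⟨x, by simp, b, by simp, n3.symm, hsymm h1, h2⟩
  · exact ⟨x, by simp, a, by simp, n1, h3, hsymm h2⟩

theorem not_closed_walk_four (hS : ∀ S : Set V, S.Nonempty → ¬ MinDegreeTwo adj S)
    (hsymm : ∀ ⦃u v⦄, adj u v → adj v u) {x a b c : V}
    (h1 : adj x a) (h2 : adj a b) (h3 : adj b c)
    (h4 : adj c x) (n1 : x ≠ b) (n2 : a ≠ c) : False := by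
  refine hS {x, a, b, c} ⟨x, by simp⟩ ?_
  rintro v (rfl | rfl | rfl | rfl)
  · exact ⟨a, by simp, c, by simp, n2, h1, hsymm h4⟩
  · exact ⟨x, by simp, b, by simp, n1, hsymm h1, h2⟩
  · exact ⟨a, by simp, c, by simp, n2, hsymm h2, h3⟩
  · exact ⟨x, by simp, b, by simp, n1, h4, hsymm h3⟩

theorem not_closed_walk_five (hS : ∀ S : Set V, S.Nonempty → ¬ MinDegreeTwo adj S)
    (hsymm : ∀ ⦃u v⦄, adj u v → adj v u) {x a b c d : V}
    (h1 : adj x a) (h2 : adj a b) (h3 : adj b c)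
    (h4 : adj c d) (h5 : adj d x) (n1 : x ≠ b) (n2 : a ≠ c) (n3 : b ≠ d) (n4 : c ≠ x)
    (n5 : d ≠ a) : False := by
  refine hS {x, a, b, c, d} ⟨x, by simp⟩ ?_
  rintro v (rfl | rfl | rfl | rfl | rfl)
  · exact ⟨a, by simp, d, by simp, n5.symm, h1, hsymm h5⟩
  · exact ⟨x, by simp, b, by simp, n1, hsymm h1, h2⟩
  · exact ⟨a, by simp, c, by simp, n2, hsymm h2, h3⟩
  · exact ⟨b, by simp, d, by simp, n3, hsymm h3, h4⟩
  · exact ⟨c, by simp, x, by simp, n4, hsymm h4, h5⟩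

theorem not_closed_walk_six (hS : ∀ S : Set V, S.Nonempty → ¬ MinDegreeTwo adj S)
    (hsymm : ∀ ⦃u v⦄, adj u v → adj v u) {x a b c d e : V}
    (h1 : adj x a) (h2 : adj a b) (h3 : adj b c)
    (h4 : adj c d) (h5 : adj d e) (h6 : adj e x) (n1 : x ≠ b) (n2 : a ≠ c) (n3 : b ≠ d)
    (n4 : c ≠ e) (n5 : d ≠ x) (n6 : e ≠ a) : False := by
  refine hS {x, a, b, c, d, e} ⟨x, by simp⟩ ?_
  rintro v (rfl | rfl | rfl | rfl | rfl | rfl)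
  · exact ⟨a, by simp, e, by simp, n6.symm, h1, hsymm h6⟩
  · exact ⟨x, by simp, b, by simp, n1, hsymm h1, h2⟩
  · exact ⟨a, by simp, c, by simp, n2, hsymm h2, h3⟩
  · exact ⟨b, by simp, d, by simp, n3, hsymm h3, h4⟩
  · exact ⟨c, by simp, e, by simp, n4, hsymm h4, h5⟩
  · exact ⟨d, by simp, x, by simp, n5, hsymm h5, h6⟩

/-- A non-backtracking walk `x, a, b, c`. -/
structure Leg (adj : V → V → Prop) (x a b c : V) : Prop where
  adj_xa : adj x a
  adj_ab : adj a b
  adj_bc : adj b c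
  b_ne_x : b ≠ x
  c_ne_a : c ≠ a

namespace Leg

variable {x a b c a' b' c' : V}

/-- Some step of the walk `x, a, b, c` is a loop. -/
def HasLoop (x a b c : V) : Prop := a = x ∨ a = b ∨ b = c

theorem c_ne_x (hS : ∀ S : Set V, S.Nonempty → ¬ MinDegreeTwo adj S)
    (hsymm : ∀ ⦃u v⦄, adj u v → adj v u) (h : Leg adj x a b c) (hl : ¬ HasLoop x a b c) :
    c ≠ x := by
  rintro rfl
  simp only [HasLoop, not_or] at hl
  exact not_closed_walk_three hS hsymm h.adj_xa h.adj_ab h.adj_bc h.c_ne_a hl.2.1 h.b_ne_x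

theorem not_hasLoop_of_hasLoop (hS : ∀ S : Set V, S.Nonempty → ¬ MinDegreeTwo adj S)
    (hsymm : ∀ ⦃u v⦄, adj u v → adj v u) (h : Leg adj x a b c) (h' : Leg adj x a' b' c')
    (hne : a ≠ a') (hl : HasLoop x a b c) : ¬ HasLoop x a' b' c' := by
  have key : ∀ {a b c}, Leg adj x a b c → HasLoop x a b c → ∃ L : Set V, a ∈ insert x L ∧
      ∀ v ∈ L, ∃ y ∈ insert x L, ∃ z ∈ insert x L, y ≠ z ∧ adj v y ∧ adj v z := by
    intro a b c h hl
    by_cases hax : a = x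
    · exact ⟨∅, by simp [hax], by simp⟩
    by_cases hab : a = b
    · refine ⟨{a}, by simp, ?_⟩
      rintro v rfl
      exact ⟨x, by simp, v, by simp, Ne.symm hax, hsymm h.adj_xa, by simpa [hab] using h.adj_ab⟩
    have hbc : b = c := by simpa [HasLoop, hax, hab] using hl
    refine ⟨{a, b}, by simp, ?_⟩
    rintro v (rfl | rfl)
    · exact ⟨x, by simp, b, by simp, h.b_ne_x.symm, hsymm h.adj_xa, h.adj_ab⟩
    · exact ⟨a, by simp, v, by simp, hab, hsymm h.adj_ab, by simpa [← hbc] using h.adj_bc⟩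
  intro hl'
  obtain ⟨L, haL, hL⟩ := key h hl
  obtain ⟨L', haL', hL'⟩ := key h' hl'
  have sub : insert x L ⊆ insert x (L ∪ L') := by grind
  have sub' : insert x L' ⊆ insert x (L ∪ L') := by grind
  refine hS (insert x (L ∪ L')) ⟨x, by simp⟩ ?_
  rintro v (rfl | hv | hv)
  · exact ⟨a, sub haL, a', sub' haL', hne, h.adj_xa, h'.adj_xa⟩
  · obtain ⟨y, hy, z, hz, h⟩ := hL v hv
    exact ⟨y, sub hy, z, sub hz, h⟩
  · obtain ⟨y, hy, z, hz, h⟩ := hL' v hv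
    exact ⟨y, sub' hy, z, sub' hz, h⟩

theorem disjoint (hS : ∀ S : Set V, S.Nonempty → ¬ MinDegreeTwo adj S)
    (hsymm : ∀ ⦃u v⦄, adj u v → adj v u) (h : Leg adj x a b c) (h' : Leg adj x a' b' c')
    (hne : a ≠ a') (hax : a ≠ x) (hax' : a' ≠ x) :
    a ≠ b' ∧ a ≠ c' ∧ b ≠ a' ∧ b ≠ b' ∧ b ≠ c' ∧ c ≠ a' ∧ c ≠ b' ∧ c ≠ c' := by
  have hab : a ≠ b' := by
    rintro rfl
    exact not_closed_walk_three hS hsymm h'.adj_xa h'.adj_ab (hsymm h.adj_xa) hax'.symm hne.symm hax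
  have hba : b ≠ a' := by
    rintro rfl
    exact not_closed_walk_three hS hsymm h.adj_xa h.adj_ab (hsymm h'.adj_xa) hax.symm hne hax'
  have hac : a ≠ c' := by
    rintro rfl
    exact not_closed_walk_four hS hsymm h'.adj_xa h'.adj_ab h'.adj_bc (hsymm h.adj_xa)
      h'.b_ne_x.symm hne.symm
  have hca : c ≠ a' := by
    rintro rfl
    exact not_closed_walk_four hS hsymm h.adj_xa h.adj_ab h.adj_bc (hsymm h'.adj_xa)
      h.b_ne_x.symm hne
  have hbb : b ≠ b' := by
    rintro rfl
    exact not_closed_walk_four hS hsymm h.adj_xa h.adj_ab (hsymm h'.adj_ab) (hsymm h'.adj_xa)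
      h.b_ne_x.symm hne
  refine ⟨hab, hac, hba, hbb, ?_, hca, ?_, ?_⟩
  · rintro rfl
    exact not_closed_walk_five hS hsymm h.adj_xa h.adj_ab (hsymm h'.adj_bc) (hsymm h'.adj_ab)
      (hsymm h'.adj_xa) h.b_ne_x.symm hab hba h'.b_ne_x hne.symm
  · rintro rfl
    exact not_closed_walk_five hS hsymm h'.adj_xa h'.adj_ab (hsymm h.adj_bc) (hsymm h.adj_ab)
      (hsymm h.adj_xa) h'.b_ne_x.symm hba.symm hab.symm h.b_ne_x hne
  · rintro rfl
    exact not_closed_walk_six hS hsymm h.adj_xa h.adj_ab h.adj_bc (hsymm h'.adj_bc)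
      (hsymm h'.adj_ab) (hsymm h'.adj_xa) h.b_ne_x.symm h.c_ne_a.symm hbb h'.c_ne_a
      h'.b_ne_x hne.symm

end Leg

theorem spiderFree (hS : ∀ S : Set V, S.Nonempty → ¬ MinDegreeTwo adj S)
    (hsymm : ∀ ⦃u v⦄, adj u v → adj v u) (h1 : ¬ HasH1 adj) (h2 : ¬ HasH2 adj)
    (h3 : ¬ HasH3 adj) (h4 : ¬ HasH4 adj) : SpiderFree adj := by
  have key : ∀ {x a₁ b₁ c₁ a₂ b₂ c₂ a₃ b₃ c₃ : V}, Leg adj x a₁ b₁ c₁ → Leg adj x a₂ b₂ c₂ →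
      Leg adj x a₃ b₃ c₃ → a₁ ≠ a₂ → a₁ ≠ a₃ → a₂ ≠ a₃ → ¬ Leg.HasLoop x a₁ b₁ c₁ →
      ¬ Leg.HasLoop x a₂ b₂ c₂ → False := by
    intro x a₁ b₁ c₁ a₂ b₂ c₂ a₃ b₃ c₃ l₁ l₂ l₃ n₁₂ n₁₃ n₂₃ p₁ p₂
    have e₁ := l₁.c_ne_x hS hsymm p₁
    have e₂ := l₂.c_ne_x hS hsymm p₂
    have e₃ := l₃.c_ne_x hS hsymm
    simp only [Leg.HasLoop, not_or] at p₁ p₂ e₃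
    have d₁₂ := l₁.disjoint hS hsymm l₂ n₁₂ p₁.1 p₂.1
    obtain ⟨A₁, B₁, C₁, D₁, E₁⟩ := l₁
    obtain ⟨A₂, B₂, C₂, D₂, E₂⟩ := id l₂
    obtain ⟨A₃, B₃, C₃, D₃, E₃⟩ := id l₃
    by_cases hax : a₃ = x
    · subst hax
      refine h4 ⟨a₃, a₁, b₁, c₁, a₂, b₂, c₂, ?_, A₁, B₁, C₁, A₂, B₂, C₂, A₃⟩
      simp only [List.nodup_cons, List.mem_cons, List.not_mem_nil, not_or, List.nodup_nil]
      grind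
    have d₁₃ := Leg.disjoint hS hsymm ⟨A₁, B₁, C₁, D₁, E₁⟩ l₃ n₁₃ p₁.1 hax
    have d₂₃ := l₂.disjoint hS hsymm l₃ n₂₃ p₂.1 hax
    by_cases hab : a₃ = b₃
    · subst hab
      refine h3 ⟨x, a₁, b₁, c₁, a₂, b₂, c₂, a₃, ?_, A₁, B₁, C₁, A₂, B₂, C₂, A₃, B₃⟩
      simp only [List.nodup_cons, List.mem_cons, List.not_mem_nil, not_or, List.nodup_nil]
      grind
    by_cases hbc : b₃ = c₃
    · subst hbc
      refine h2 ⟨x, a₁, b₁, c₁, a₂, b₂, c₂, a₃, b₃, ?_, A₁, B₁, C₁, A₂, B₂, C₂, A₃, B₃, C₃⟩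
      simp only [List.nodup_cons, List.mem_cons, List.not_mem_nil, not_or, List.nodup_nil]
      grind
    · have e₃ := e₃ ⟨hax, hab, hbc⟩
      refine h1 ⟨x, a₁, b₁, c₁, a₂, b₂, c₂, a₃, b₃, c₃, ?_, A₁, B₁, C₁, A₂, B₂, C₂, A₃, B₃, C₃⟩
      simp only [List.nodup_cons, List.mem_cons, List.not_mem_nil, not_or, List.nodup_nil]
      grind
  rintro x a₁ a₂ a₃ A₁ A₂ A₃ ⟨b₁, c₁, B₁, D₁, C₁, E₁⟩ ⟨b₂, c₂, B₂, D₂, C₂, E₂⟩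
    ⟨b₃, c₃, B₃, D₃, C₃, E₃⟩ n₁₂ n₁₃ n₂₃
  have l₁ : Leg adj x a₁ b₁ c₁ := ⟨A₁, B₁, C₁, D₁, E₁⟩
  have l₂ : Leg adj x a₂ b₂ c₂ := ⟨A₂, B₂, C₂, D₂, E₂⟩
  have l₃ : Leg adj x a₃ b₃ c₃ := ⟨A₃, B₃, C₃, D₃, E₃⟩
  by_cases p₁ : Leg.HasLoop x a₁ b₁ c₁
  · exact key l₂ l₃ l₁ n₂₃ n₁₂.symm n₁₃.symm (l₁.not_hasLoop_of_hasLoop hS hsymm l₂ n₁₂ p₁)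
      (l₁.not_hasLoop_of_hasLoop hS hsymm l₃ n₁₃ p₁)
  by_cases p₂ : Leg.HasLoop x a₂ b₂ c₂
  · exact key l₁ l₃ l₂ n₁₃ n₁₂ n₂₃.symm p₁ (l₂.not_hasLoop_of_hasLoop hS hsymm l₃ n₂₃ p₂)
  · exact key l₁ l₂ l₃ n₁₂ n₁₃ n₂₃ p₁ p₂

theorem mem_or_mem_of_ncard_le_one [Finite V] {w : Set V} (hw : w.ncard ≤ 1) {p q : V}
    (hpq : p ≠ q) : p ∉ w ∨ q ∉ w := by
  by_contra! h
  exact hpq ((Set.ncard_le_one_iff (Set.toFinite w)).1 hw h.1 h.2)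

theorem terr_ne_empty_of_minDegreeTwo [Finite V] {S : Set V} (hne : S.Nonempty)
    (hS : MinDegreeTwo adj S) {W : ℕ → Set V} (hW : UsesAtMost W 1) (T : ℕ) :
    terr adj Set.univ W T ≠ ∅ := by
  suffices ∃ v ∈ S, v ∈ terr adj Set.univ W T by
    obtain ⟨v, _, hv⟩ := this
    exact Set.nonempty_iff_ne_empty.1 ⟨v, hv⟩
  induction T with
  | zero =>
    obtain ⟨v, hv⟩ := hne
    obtain ⟨y, hy, z, hz, hyz, -⟩ := hS v hv
    rcases mem_or_mem_of_ncard_le_one (hW 0) hyz with h | h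
    · exact ⟨y, hy, trivial, h⟩
    · exact ⟨z, hz, trivial, h⟩
  | succ T ih =>
    obtain ⟨v, hv, hvT⟩ := ih
    obtain ⟨y, hy, z, hz, hyz, hvy, hvz⟩ := hS v hv
    rcases mem_or_mem_of_ncard_le_one (hW (T + 1)) hyz with h | h
    · exact ⟨y, hy, ⟨v, hvT, hvy⟩, h⟩
    · exact ⟨z, hz, ⟨v, hvT, hvz⟩, h⟩

theorem terr_ne_empty_of_hasCycle [Finite V] (hsymm : ∀ ⦃u v⦄, adj u v → adj v u)
    (h : HasCycle adj) {W : ℕ → Set V} (hW : UsesAtMost W 1) (T : ℕ) :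
    terr adj Set.univ W T ≠ ∅ := by
  obtain ⟨m, v, hinj, hadj⟩ := h
  refine terr_ne_empty_of_minDegreeTwo (S := Set.range v) (Set.range_nonempty v) ?_ hW T
  rintro _ ⟨i, rfl⟩
  refine ⟨_, ⟨i + 1, rfl⟩, _, ⟨i - 1, rfl⟩, fun h => ?_, hadj i, hsymm ?_⟩
  · have h2 : (1 + 1 : Fin (m + 3)) = 0 := by
      have := hinj h
      have h3 : i + (1 + 1) = i + 0 := by rw [← add_assoc, this]; simp
      exact add_left_cancel h3
    have := congrArg Fin.val h2
    simp [Fin.val_add, Nat.mod_eq_of_lt (show 2 < m + 3 by omega)] at this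
  · simpa using hadj (i - 1)

theorem terr_ne_empty_of_hasTwoLoops [Finite V] (hsymm : ∀ ⦃u v⦄, adj u v → adj v u)
    (h : HasTwoLoopsJoinedByPath adj) {W : ℕ → Set V} (hW : UsesAtMost W 1) (T : ℕ) :
    terr adj Set.univ W T ≠ ∅ := by
  obtain ⟨m, v, hinj, hadj, h0, hlast⟩ := h
  have hne : ∀ i j : Fin (m + 2), (i : ℕ) ≠ j → v i ≠ v j :=
    fun i j hij h => hij (congrArg Fin.val (hinj h))
  have hadj' : ∀ k (hk : k + 1 < m + 2), adj (v ⟨k, by omega⟩) (v ⟨k + 1, hk⟩) :=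
    fun k hk => hadj ⟨k, by omega⟩
  refine terr_ne_empty_of_minDegreeTwo (S := Set.range v) (Set.range_nonempty v) ?_ hW T
  rintro _ ⟨⟨i, hi⟩, rfl⟩
  by_cases hi0 : i = 0
  · subst hi0
    exact ⟨_, ⟨0, rfl⟩, _, ⟨⟨1, by omega⟩, rfl⟩, hne _ _ (by simp), h0, hadj' 0 (by omega)⟩
  obtain ⟨j, rfl⟩ := Nat.exists_eq_succ_of_ne_zero hi0
  by_cases hl : j = m
  · subst hl
    exact ⟨_, ⟨⟨j, by omega⟩, rfl⟩, _, ⟨Fin.last (j + 1), rfl⟩, hne _ _ (by simp),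
      hsymm (hadj' j hi), hlast⟩
  · exact ⟨_, ⟨⟨j, by omega⟩, rfl⟩, _, ⟨⟨j + 2, by omega⟩, rfl⟩, hne _ _ (by simp),
      hsymm (hadj' j hi), hadj' (j + 1) (by omega)⟩

/-- A spider with three legs of length three, possibly folded by a homomorphism that is injective
on the vertices relevant to the rabbit. -/
structure FoldedSpider (adj : V → V → Prop) (x : V) (a b c : Fin 3 → V) : Prop where
  adj_xa : ∀ i, adj x (a i)
  adj_ab : ∀ i, adj (a i) (b i)
  adj_bc : ∀ i, adj (b i) (c i)
  a_inj : Function.Injective a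
  b_inj : Function.Injective b
  b_ne_x : ∀ i, b i ≠ x
  a_ne_c : ∀ i, a i ≠ c i

/-- The territory `R` contains two of the center and the middle vertices of the legs. -/
def MeetsTwice (x : V) (b : Fin 3 → V) (R : Set V) : Prop :=
  ∃ i, b i ∈ R ∧ (x ∈ R ∨ ∃ j ≠ i, b j ∈ R)

namespace FoldedSpider

variable {x : V} {a b c : Fin 3 → V}

theorem meetsTwice_diff [Finite V] (h : FoldedSpider adj x a b c) {Z w : Set V}
    (hw : w.ncard ≤ 1) (hx : x ∈ Z) {i j : Fin 3} (hij : j ≠ i) (hi : b i ∈ Z) (hj : b j ∈ Z) :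
    MeetsTwice x b (Z \ w) := by
  have h1 := mem_or_mem_of_ncard_le_one hw (h.b_ne_x i)
  have h2 := mem_or_mem_of_ncard_le_one hw (h.b_ne_x j)
  have h3 := mem_or_mem_of_ncard_le_one hw (h.b_inj.ne hij)
  by_cases hi' : b i ∈ w
  · exact ⟨j, ⟨hj, by tauto⟩, .inl ⟨hx, by tauto⟩⟩
  by_cases hj' : b j ∈ w
  · exact ⟨i, ⟨hi, by tauto⟩, .inl ⟨hx, by tauto⟩⟩
  · exact ⟨i, ⟨hi, hi'⟩, .inr ⟨j, hij, hj, hj'⟩⟩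

theorem meetsTwice_step [Finite V] (hsymm : ∀ ⦃u v⦄, adj u v → adj v u)
    (h : FoldedSpider adj x a b c) {R w w' : Set V} (hw : w.ncard ≤ 1) (hw' : w'.ncard ≤ 1)
    (hR : MeetsTwice x b R) : MeetsTwice x b (nbhd adj (nbhd adj R \ w) \ w') := by
  have hb : ∀ i, b i ∈ R → b i ∈ nbhd adj (nbhd adj R \ w) := by
    intro i hi
    rcases mem_or_mem_of_ncard_le_one hw (h.a_ne_c i) with hw | hw
    · exact ⟨a i, ⟨⟨b i, hi, hsymm (h.adj_ab i)⟩, hw⟩, h.adj_ab i⟩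
    · exact ⟨c i, ⟨⟨b i, hi, h.adj_bc i⟩, hw⟩, hsymm (h.adj_bc i)⟩
  have hx : ∀ i j, j ≠ i → a i ∈ nbhd adj R → a j ∈ nbhd adj R →
      x ∈ nbhd adj (nbhd adj R \ w) := by
    intro i j hij hi hj
    rcases mem_or_mem_of_ncard_le_one hw (h.a_inj.ne hij) with hw | hw
    · exact ⟨a j, ⟨hj, hw⟩, hsymm (h.adj_xa j)⟩
    · exact ⟨a i, ⟨hi, hw⟩, hsymm (h.adj_xa i)⟩
  have ha : ∀ i, b i ∈ R → a i ∈ nbhd adj R := fun i hi => ⟨b i, hi, hsymm (h.adj_ab i)⟩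
  obtain ⟨i, hi, hxR | ⟨j, hij, hj⟩⟩ := hR
  · have ha' : ∀ i, a i ∈ nbhd adj R := fun i => ⟨x, hxR, h.adj_xa i⟩
    obtain ⟨j, k, hji, hki, hjk⟩ : ∃ j k : Fin 3, j ≠ i ∧ k ≠ i ∧ j ≠ k :=
      (by decide : ∀ i : Fin 3, ∃ j k : Fin 3, j ≠ i ∧ k ≠ i ∧ j ≠ k) i
    have hxN := hx i j hji (ha' i) (ha' j)
    rcases mem_or_mem_of_ncard_le_one hw (h.a_inj.ne hjk) with hw | hw
    · exact h.meetsTwice_diff hw' hxN hji (hb i hi) ⟨a j, ⟨ha' j, hw⟩, h.adj_ab j⟩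
    · exact h.meetsTwice_diff hw' hxN hki (hb i hi) ⟨a k, ⟨ha' k, hw⟩, h.adj_ab k⟩
  · exact h.meetsTwice_diff hw' (hx i j hij (ha i hi) (ha j hj)) hij (hb i hi) (hb j hj)

theorem terr_ne_empty [Finite V] (hsymm : ∀ ⦃u v⦄, adj u v → adj v u)
    (h : FoldedSpider adj x a b c) {W : ℕ → Set V} (hW : UsesAtMost W 1) (T : ℕ) :
    terr adj Set.univ W T ≠ ∅ := by
  have heven : ∀ t, MeetsTwice x b (terr adj Set.univ W (2 * t)) := by
    intro t
    induction t with
    | zero =>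
      exact h.meetsTwice_diff (hW 0) trivial (show (1 : Fin 3) ≠ 0 by decide) trivial trivial
    | succ t ih => exact h.meetsTwice_step hsymm (hW _) (hW _) ih
  intro hT
  have hlate : ∀ s, terr adj Set.univ W (T + s) = ∅ := by
    intro s
    induction s with
    | zero => exact hT
    | succ s ih =>
      change nbhd adj (terr adj Set.univ W (T + s)) \ _ = ∅
      simp [ih, nbhd]
  obtain ⟨i, hi, _⟩ := heven T
  rw [two_mul, hlate T] at hi
  exact hi

end FoldedSpider

theorem exists_foldedSpider (hsymm : ∀ ⦃u v⦄, adj u v → adj v u)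
    (h : HasH1 adj ∨ HasH2 adj ∨ HasH3 adj ∨ HasH4 adj) :
    ∃ x a b c, FoldedSpider adj x a b c := by
  have mk : ∀ {x a₁ b₁ c₁ a₂ b₂ c₂ a₃ b₃ c₃ : V}, Leg adj x a₁ b₁ c₁ → Leg adj x a₂ b₂ c₂ →
      Leg adj x a₃ b₃ c₃ → [a₁, a₂, a₃].Nodup → [b₁, b₂, b₃].Nodup →
      ∃ x a b c, FoldedSpider adj x a b c := by
    intro x a₁ b₁ c₁ a₂ b₂ c₂ a₃ b₃ c₃ h₁ h₂ h₃ ha hb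
    refine ⟨x, ![a₁, a₂, a₃], ![b₁, b₂, b₃], ![c₁, c₂, c₃], ?_, ?_, ?_, ?_, ?_, ?_, ?_⟩
    · simp [Fin.forall_fin_succ, h₁.adj_xa, h₂.adj_xa, h₃.adj_xa]
    · simp [Fin.forall_fin_succ, h₁.adj_ab, h₂.adj_ab, h₃.adj_ab]
    · simp [Fin.forall_fin_succ, h₁.adj_bc, h₂.adj_bc, h₃.adj_bc]
    · exact List.nodup_ofFn.1 (by simpa using ha)
    · exact List.nodup_ofFn.1 (by simpa using hb)
    · simp [Fin.forall_fin_succ, h₁.b_ne_x, h₂.b_ne_x, h₃.b_ne_x]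
    · simp [Fin.forall_fin_succ, h₁.c_ne_a.symm, h₂.c_ne_a.symm, h₃.c_ne_a.symm]
  rcases h with h | h | h | h
  · obtain ⟨x, a₁, b₁, c₁, a₂, b₂, c₂, a₃, b₃, c₃, hn, A₁, B₁, C₁, A₂, B₂, C₂, A₃, B₃, C₃⟩ := h
    simp only [List.nodup_cons, List.mem_cons, List.not_mem_nil, not_or] at hn
    refine mk (x := x) ⟨A₁, B₁, C₁, ?_, ?_⟩ ⟨A₂, B₂, C₂, ?_, ?_⟩ ⟨A₃, B₃, C₃, ?_, ?_⟩ ?_ ?_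
    all_goals grind
  · obtain ⟨x, a₁, b₁, c₁, a₂, b₂, c₂, a₃, b₃, hn, A₁, B₁, C₁, A₂, B₂, C₂, A₃, B₃, C₃⟩ := h
    simp only [List.nodup_cons, List.mem_cons, List.not_mem_nil, not_or] at hn
    refine mk (x := x) ⟨A₁, B₁, C₁, ?_, ?_⟩ ⟨A₂, B₂, C₂, ?_, ?_⟩ ⟨A₃, B₃, C₃, ?_, ?_⟩ ?_ ?_
    all_goals grind
  · obtain ⟨x, a₁, b₁, c₁, a₂, b₂, c₂, a₃, hn, A₁, B₁, C₁, A₂, B₂, C₂, A₃, B₃⟩ := h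
    simp only [List.nodup_cons, List.mem_cons, List.not_mem_nil, not_or] at hn
    refine mk (x := x) ⟨A₁, B₁, C₁, ?_, ?_⟩ ⟨A₂, B₂, C₂, ?_, ?_⟩ ⟨A₃, B₃, hsymm A₃, ?_, ?_⟩ ?_ ?_
    all_goals grind
  · obtain ⟨x, a₁, b₁, c₁, a₂, b₂, c₂, hn, A₁, B₁, C₁, A₂, B₂, C₂, A₃⟩ := h
    simp only [List.nodup_cons, List.mem_cons, List.not_mem_nil, not_or] at hn
    refine mk (x := x) ⟨A₁, B₁, C₁, ?_, ?_⟩ ⟨A₂, B₂, C₂, ?_, ?_⟩ ⟨A₃, A₁, B₁, ?_, ?_⟩ ?_ ?_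
    all_goals grind

theorem terr_nonempty_of_no_hunters [Nonempty V] (hniso : ∀ v, ∃ u, adj v u) {W : ℕ → Set V}
    (hW : ∀ t, W t = ∅) (T : ℕ) : (terr adj Set.univ W T).Nonempty := by
  induction T with
  | zero => simp [terr, hW]
  | succ T ih =>
    obtain ⟨v, hv⟩ := ih
    obtain ⟨u, hu⟩ := hniso v
    exact ⟨u, ⟨v, hv, hu⟩, by simp [hW]⟩

theorem huntingNumber_eq_one_iff [Finite V] [Nonempty V] (hniso : ∀ v, ∃ u, adj v u) :
    huntingNumber adj = 1 ↔
      ∃ W : ℕ → Set V, UsesAtMost W 1 ∧ ∃ T, terr adj Set.univ W T = ∅ := by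
  unfold huntingNumber huntingNumberFrom
  constructor
  · intro h
    have := Nat.sInf_mem (Nat.nonempty_of_sInf_eq_succ h)
    rwa [h] at this
  · refine fun h => le_antisymm (Nat.sInf_le h) ?_
    refine le_csInf ⟨1, h⟩ ?_
    rintro k ⟨W, hW, T, hT⟩
    by_contra! hk
    have hempty : ∀ t, W t = ∅ := fun t => by
      have := hW t
      exact (Set.ncard_eq_zero (Set.toFinite _)).1 (by omega)
    exact (terr_nonempty_of_no_hunters hniso hempty T).ne_empty hT

end HuntersRabbit

/-- a (nonempty) finite graph with loops and no isolated vertices is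
`1`-hunterwin, i.e. `h(G) = 1`, iff it contains none of: a cycle, two looped vertices
joined by a path, `H_1`, `H_2`, `H_3`, `H_4`. -/
theorem one_hunterwin_characterization {V : Type*} [Fintype V] [Nonempty V]
    (adj : V → V → Prop) (hsymm : Symmetric adj) (hniso : ∀ v, ∃ u, adj v u) :
    huntingNumber adj = 1 ↔
      ¬HasCycle adj ∧ ¬HasTwoLoopsJoinedByPath adj ∧
      ¬HasH1 adj ∧ ¬HasH2 adj ∧ ¬HasH3 adj ∧ ¬HasH4 adj := by
  rw [HuntersRabbit.huntingNumber_eq_one_iff hniso]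
  constructor
  · rintro ⟨W, hW, T, hT⟩
    have hsp : ¬ (HasH1 adj ∨ HasH2 adj ∨ HasH3 adj ∨ HasH4 adj) := fun h => by
      obtain ⟨x, a, b, c, h⟩ := HuntersRabbit.exists_foldedSpider hsymm h
      exact h.terr_ne_empty hsymm hW T hT
    simp only [not_or] at hsp
    exact ⟨fun h => HuntersRabbit.terr_ne_empty_of_hasCycle hsymm h hW T hT,
      fun h => HuntersRabbit.terr_ne_empty_of_hasTwoLoops hsymm h hW T hT, hsp⟩
  · rintro ⟨hcyc, hloops, h1, h2, h3, h4⟩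
    have hS : ∀ S : Set V, S.Nonempty → ¬ HuntersRabbit.MinDegreeTwo adj S := fun S hne hS =>
      (HuntersRabbit.hasCycle_or_hasTwoLoops hsymm hne hS).elim hcyc hloops
    exact (HuntersRabbit.huntable_univ hsymm (HuntersRabbit.wellFounded_dartNext hS hsymm)
      (HuntersRabbit.spiderFree hS hsymm h1 h2 h3 h4)).exists_strategy
end
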